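/- Let C, C₁, C₂, … be d-dimensional Archimedean copulas. Then the following are equivalent: (i) (C_n) converges uniformly (equivalently, pointwise) to C on [0,1]^d; (ii) (C_n) converges to C with respect to the Markov-kernel metric D₁; (iii) (C_n) converges to C with respect to D₂; (iv) (C_n) converges to C with respect to D_∞; (v) (C_n) converges 1-weakly conditional to C. -/

import Mathlib

open MeasureTheory ProbabilityTheory Set Filter Topology
open scoped ENNReal

noncomputable section
attribute [local instance] Classical.propDecidable

/-- The lower-orthant box `[0, y] = [0,y₁] × ⋯ × [0,y_k]` (as a lower set in `ℝ^k`;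
all measures considered are supported on the unit cube). -/
def lowerBox {k : ℕ} (y : Fin k → ℝ) : Set (Fin k → ℝ) := {t | ∀ i, t i ≤ y i}

/-- The closed unit cube `[0,1]^k`. -/
def unitCube (k : ℕ) : Set (Fin k → ℝ) := {t | ∀ i, t i ∈ Icc (0 : ℝ) 1}

/-- Evaluation of a generator `ψ` at an extended-real argument, with `ψ(∞) = 0`. -/
def evalPsi (ψ : ℝ → ℝ) (s : ℝ≥0∞) : ℝ := if s = ∞ then 0 else ψ s.toReal

/-- `ψ^{(ℓ)}(s)`, with `ψ^{(ℓ)}` replaced by the left-hand derivative `D⁻ψ^{(d−2)}`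
when `ℓ = d − 1`, and extended by `0` at `s = ∞`. -/
def psiD (d l : ℕ) (ψ : ℝ → ℝ) (s : ℝ≥0∞) : ℝ :=
  if s = ∞ then 0
  else if l = d - 1 then derivWithin (iteratedDeriv (d - 2) ψ) (Iio s.toReal) s.toReal
  else iteratedDeriv l ψ s.toReal

/-- `ψ` is a `d`-monotone Archimedean generator, with pseudoinverse `φ`
(valued in `ℝ≥0∞`; `φ 0 = inf{z : ψ(z) = 0}` which equals `∞` iff the generator is strict). -/
structure IsGenerator (d : ℕ) (ψ : ℝ → ℝ) (φ : ℝ → ℝ≥0∞) : Prop where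
  continuousOn : ContinuousOn ψ (Ici 0)
  at_zero : ψ 0 = 1
  tendsto_zero : Tendsto ψ atTop (nhds 0)
  nonneg : ∀ z : ℝ, 0 ≤ z → 0 ≤ ψ z
  antitoneOn : AntitoneOn ψ (Ici 0)
  strict_anti : ∀ z₁ z₂ : ℝ, 0 ≤ z₁ → z₁ < z₂ → 0 < ψ z₂ → ψ z₂ < ψ z₁
  smooth : ∀ z : ℝ, 0 < z → ContDiffAt ℝ ((d - 2 : ℕ) : ℕ∞) ψ z
  alt_sign : ∀ m : ℕ, m ≤ d - 2 → ∀ z : ℝ, 0 < z → 0 ≤ (-1 : ℝ) ^ m * iteratedDeriv m ψ z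
  top_antitone : AntitoneOn (fun z => (-1 : ℝ) ^ (d - 2) * iteratedDeriv (d - 2) ψ z) (Ioi 0)
  top_convex : ConvexOn ℝ (Ioi 0) (fun z => (-1 : ℝ) ^ (d - 2) * iteratedDeriv (d - 2) ψ z)
  phi_finite : ∀ t : ℝ, 0 < t → φ t ≠ ∞
  phi_one : φ 1 = 0
  phi_antitoneOn : AntitoneOn φ (Ioc 0 1)
  psi_phi : ∀ t : ℝ, 0 < t → t ≤ 1 → evalPsi ψ (φ t) = t
  phi_zero : φ 0 = sInf {s : ℝ≥0∞ | evalPsi ψ s = 0}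

/-- The explicit formula for the `ℓ`-Markov kernel of the Archimedean copula generated by
`ψ`, evaluated at the box `[0,y]`.  The first case is `min(x) = 1` or `x ∈ L₀^{1:ℓ}`
(the latter meaning `C^{1:ℓ}(x) = ψ(Σᵢφ(xᵢ)) = 0`); the second case is
`(x,y) ∈ int L₀` (i.e. `Σᵢφ(xᵢ) + Σⱼφ(yⱼ) > φ(0) = inf{z : ψ(z) = 0}`); the third case is
the ratio `ψ^{(ℓ)}(Σᵢφ(xᵢ) + Σⱼφ(yⱼ)) / ψ^{(ℓ)}(Σᵢφ(xᵢ))`. -/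
def archK (d l : ℕ) (ψ : ℝ → ℝ) (φ : ℝ → ℝ≥0∞) (x : Fin l → ℝ) (y : Fin (d - l) → ℝ) : ℝ :=
  if (∀ i, x i = 1) ∨ evalPsi ψ (∑ i, φ (x i)) = 0 then 1
  else if ∃ t : ℝ≥0∞, t < (∑ i, φ (x i)) + ∑ j, φ (y j) ∧ evalPsi ψ t = 0 then 0
  else psiD d l ψ ((∑ i, φ (x i)) + ∑ j, φ (y j)) / psiD d l ψ (∑ i, φ (x i))

/-- `K` disintegrates `μ` over its first marginal:
`μ(G) = ∫ K(x, G_x) dμ^{1:ℓ}(x)` for every Borel set `G`. -/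
def IsDisintegration {α β : Type*} [MeasurableSpace α] [MeasurableSpace β]
    (μ : Measure (α × β)) (K : Kernel α β) : Prop :=
  ∀ G : Set (α × β), MeasurableSet G →
    μ G = ∫⁻ a, K a (Prod.mk a ⁻¹' G) ∂(μ.map Prod.fst)

/-- Weak convergence of a sequence of (probability) measures. -/
def WeakConv {α : Type*} [MeasurableSpace α] [TopologicalSpace α]
    (μn : ℕ → Measure α) (μ : Measure α) : Prop :=
  ∀ f : BoundedContinuousFunction α ℝ,
    Tendsto (fun n => ∫ a, f a ∂(μn n)) atTop (nhds (∫ a, f a ∂μ))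

/-- The copula function of a `d`-dimensional Archimedean copula, viewed on
`ℝ × ℝ^{d-1}` (first coordinate separated, as relevant for `1`-Markov kernels). -/
def copFun2 (d : ℕ) (ψ : ℝ → ℝ) (φ : ℝ → ℝ≥0∞) (p : ℝ × (Fin (d - 1) → ℝ)) : ℝ :=
  evalPsi ψ (φ p.1 + ∑ j, φ (p.2 j))

/-- The Markov-kernel metric `D₁`. -/
def D1 {m : ℕ} (K K' : Kernel ℝ (Fin m → ℝ)) : ℝ :=
  ∫ p in (Icc (0:ℝ) 1) ×ˢ unitCube m,
    |(K p.1 (lowerBox p.2)).toReal - (K' p.1 (lowerBox p.2)).toReal|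

/-- The square of the Markov-kernel metric `D₂`. -/
def D2sq {m : ℕ} (K K' : Kernel ℝ (Fin m → ℝ)) : ℝ :=
  ∫ p in (Icc (0:ℝ) 1) ×ˢ unitCube m,
    ((K p.1 (lowerBox p.2)).toReal - (K' p.1 (lowerBox p.2)).toReal) ^ 2

/-- The Markov-kernel metric `D_∞`. -/
def Dinf {m : ℕ} (K K' : Kernel ℝ (Fin m → ℝ)) : ℝ :=
  ⨆ y ∈ unitCube m,
    ∫ x in Icc (0:ℝ) 1, |(K x (lowerBox y)).toReal - (K' x (lowerBox y)).toReal|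

/-- limit of one-sided inequality against left difference quotients -/
lemma le_of_left_quot {F : ℝ → ℝ} {x k A B : ℝ} (hF : HasDerivAt F k x)
    (h : ∀ᶠ a in 𝓝[<] x, (x - a) * A ≤ (F x - F a) * B) : A ≤ k * B := by
  have h1 : Tendsto (slope F x) (𝓝[<] x) (𝓝 k) :=
    (hasDerivAt_iff_tendsto_slope.1 hF).mono_left (nhdsWithin_mono _ (by intro y hy; simpa using ne_of_lt hy))
  refine ge_of_tendsto (h1.mul_const B) ?_
  filter_upwards [h, self_mem_nhdsWithin] with a ha hax
  have hax' : 0 < x - a := sub_pos.2 hax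
  have : slope F x a = (F x - F a) / (x - a) := by
    rw [slope_def_field, ← neg_sub (F x), ← neg_sub x, neg_div_neg_eq]
  rw [this, div_mul_eq_mul_div, le_div_iff₀ hax']
  linarith

lemma ge_of_left_quot {F : ℝ → ℝ} {x k A B : ℝ} (hF : HasDerivAt F k x)
    (h : ∀ᶠ a in 𝓝[<] x, (F x - F a) * B ≤ (x - a) * A) : k * B ≤ A := by
  have := le_of_left_quot (A := -A) (B := -B) hF (by
    filter_upwards [h] with a ha; linarith)
  linarith

lemma cvx_three {f : ℝ → ℝ} (hf : ConvexOn ℝ (Ioo 0 1) f) {a b c : ℝ} (ha : 0 < a) (hab : a ≤ b)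
    (hbc : b ≤ c) (hc : c < 1) : (c - a) * f b ≤ (c - b) * f a + (b - a) * f c := by
  rcases hab.eq_or_lt with rfl | hab
  · linarith
  rcases hbc.eq_or_lt with rfl | hbc
  · linarith
  have := hf.slope_mono_adjacent (x := a) (y := b) (z := c) ⟨ha, by linarith⟩ ⟨by linarith, hc⟩ hab hbc
  rw [div_le_div_iff₀ (by linarith) (by linarith)] at this
  nlinarith

/-- lower bound -/
lemma key_lower {f F : ℝ → ℝ} {x k s x2 u1 : ℝ} (hf : ConvexOn ℝ (Ioo 0 1) f)
    (hx : x ∈ Ioo (0:ℝ) 1) (hF : HasDerivAt F k x) (hmono : ∀ a ∈ Ioo (0:ℝ) x, F a ≤ F x)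
    (hpos : 0 < F x) (hlt : F x < 1)
    (heq : ∀ a ∈ Ioc (0:ℝ) x, 0 < F a → f (F a) = f a + s)
    (hx2 : x < x2) (hx2' : x2 < 1) (hu1 : 0 < u1) (hu1' : u1 < F x) :
    (f x - f x2) / (x2 - x) ≤ k * ((f u1 - f (F x)) / (F x - u1)) := by
  apply le_of_left_quot hF
  have e1 : ∀ᶠ a in 𝓝[<] x, u1 < F a :=
    (hF.continuousAt.tendsto.mono_left nhdsWithin_le_nhds).eventually (lt_mem_nhds hu1')
  have e2 : ∀ᶠ a in 𝓝[<] x, 0 < a :=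
    nhdsWithin_le_nhds (lt_mem_nhds hx.1)
  filter_upwards [e1, e2, self_mem_nhdsWithin] with a h1 h2 h3
  have h3' : a < x := h3
  have q1 := heq a ⟨h2, h3'.le⟩ (by linarith)
  have q2 := heq x ⟨hx.1, le_rfl⟩ hpos
  have c1 := cvx_three hf hu1 h1.le (hmono a ⟨h2, h3'⟩) hlt
  have c2 := cvx_three hf h2 h3'.le hx2.le hx2'
  have d1 : (x - a) * ((f x - f x2) / (x2 - x)) ≤ f a - f x := by
    rw [mul_div_assoc', div_le_iff₀ (by linarith)]; nlinarith
  have d2 : f (F a) - f (F x) ≤ (F x - F a) * ((f u1 - f (F x)) / (F x - u1)) := by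
    rw [mul_div_assoc', le_div_iff₀ (by linarith)]; nlinarith
  linarith

lemma key_upper {f F : ℝ → ℝ} {x k s x1 u2 : ℝ} (hf : ConvexOn ℝ (Ioo 0 1) f)
    (hx : x ∈ Ioo (0:ℝ) 1) (hF : HasDerivAt F k x) (hmono : ∀ a ∈ Ioo (0:ℝ) x, F a ≤ F x)
    (hpos : 0 < F x)
    (heq : ∀ a ∈ Ioc (0:ℝ) x, 0 < F a → f (F a) = f a + s)
    (hx1 : x1 < x) (hx1' : 0 < x1) (hu2 : F x < u2) (hu2' : u2 < 1) :
    k * ((f (F x) - f u2) / (u2 - F x)) ≤ (f x1 - f x) / (x - x1) := by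
  apply ge_of_left_quot hF
  have e1 : ∀ᶠ a in 𝓝[<] x, 0 < F a :=
    (hF.continuousAt.tendsto.mono_left nhdsWithin_le_nhds).eventually (lt_mem_nhds hpos)
  have e2 : ∀ᶠ a in 𝓝[<] x, x1 < a :=
    nhdsWithin_le_nhds (lt_mem_nhds hx1)
  filter_upwards [e1, e2, self_mem_nhdsWithin] with a h1 h2 h3
  have h3' : a < x := h3
  have h0 : 0 < a := by linarith
  have q1 := heq a ⟨h0, h3'.le⟩ h1
  have q2 := heq x ⟨hx.1, le_rfl⟩ hpos
  have c1 := cvx_three hf h1 (hmono a ⟨h0, h3'⟩) hu2.le hu2'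
  have c2 := cvx_three hf hx1' h2.le h3'.le hx.2
  have d1 : f a - f x ≤ (x - a) * ((f x1 - f x) / (x - x1)) := by
    rw [mul_div_assoc', le_div_iff₀ (by linarith)]; nlinarith
  have d2 : (F x - F a) * ((f (F x) - f u2) / (u2 - F x)) ≤ f (F a) - f (F x) := by
    rw [mul_div_assoc', div_le_iff₀ (by linarith)]; nlinarith
  linarith

lemma sandwich {κ : ℕ → ℝ} {k : ℝ} {Ln Un : ℝ → ℕ → ℝ} {L U : ℝ → ℝ}
    (hL : ∀ᶠ h in 𝓝[>] (0:ℝ), (∀ᶠ n in atTop, Ln h n ≤ κ n) ∧ Tendsto (Ln h) atTop (𝓝 (L h)))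
    (hU : ∀ᶠ h in 𝓝[>] (0:ℝ), (∀ᶠ n in atTop, κ n ≤ Un h n) ∧ Tendsto (Un h) atTop (𝓝 (U h)))
    (hL' : Tendsto L (𝓝[>] 0) (𝓝 k)) (hU' : Tendsto U (𝓝[>] 0) (𝓝 k)) :
    Tendsto κ atTop (𝓝 k) := by
  rw [tendsto_order]
  constructor
  · intro c hc
    obtain ⟨h, ⟨h1, h2⟩, h3⟩ := (hL.and (hL'.eventually (lt_mem_nhds hc))).exists
    filter_upwards [h1, h2.eventually (lt_mem_nhds h3)] with n a b using b.trans_le a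
  · intro c hc
    obtain ⟨h, ⟨h1, h2⟩, h3⟩ := (hU.and (hU'.eventually (gt_mem_nhds hc))).exists
    filter_upwards [h1, h2.eventually (gt_mem_nhds h3)] with n a b using a.trans_lt b

/-- The data of a generator / section needed in the analytic part. -/
structure Sec (f F : ℝ → ℝ) (s : ℝ) : Prop where
  cvx : ConvexOn ℝ (Ioo 0 1) f
  anti : StrictAntiOn f (Ioc 0 1)
  mono : MonotoneOn F (Icc 0 1)
  nonneg : ∀ a ∈ Icc (0:ℝ) 1, 0 ≤ F a
  le : ∀ a ∈ Icc (0:ℝ) 1, F a ≤ a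
  eq : ∀ a ∈ Ioc (0:ℝ) 1, 0 < F a → f (F a) = f a + s
  zero : ∀ a ∈ Ioc (0:ℝ) 1, F a = 0 → ∀ v ∈ Ioc (0:ℝ) 1, f v ≤ f a + s

lemma hasDeriv_quot_right {f : ℝ → ℝ} {x p : ℝ} (h : HasDerivAt f p x) :
    Tendsto (fun h => (f (x + h) - f x) / h) (𝓝[>] 0) (𝓝 p) := by
  have := h.tendsto_slope_zero_right
  simpa [div_eq_inv_mul] using this

lemma hasDeriv_quot_left {f : ℝ → ℝ} {x p : ℝ} (h : HasDerivAt f p x) :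
    Tendsto (fun h => (f x - f (x - h)) / h) (𝓝[>] 0) (𝓝 p) := by
  have h1 : HasDerivAt (fun y => - f (2 * x - y)) p x := by
    have h2 : HasDerivAt f p (2 * x - x) := by rw [two_mul, add_sub_cancel_right]; exact h
    have := (h2.comp x ((hasDerivAt_id x).const_sub (2 * x))).neg
    convert! this using 1
    simp
  have := hasDeriv_quot_right h1
  refine this.congr fun t => ?_
  have e1 : 2 * x - (x + t) = x - t := by ring
  have e2 : 2 * x - x = x := by ring
  rw [e1, e2]; ring

lemma sec_pos_case {f F : ℝ → ℝ} {s : ℝ} (S : Sec f F s)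
    {fn Fn : ℕ → ℝ → ℝ} {sn : ℕ → ℝ} (Sn : ∀ n, Sec (fn n) (Fn n) (sn n))
    (hf : ∀ a ∈ Ioc (0:ℝ) 1, Tendsto (fun n => fn n a) atTop (𝓝 (f a)))
    (hs : Tendsto sn atTop (𝓝 s))
    {x : ℝ} (hx : x ∈ Ioo (0:ℝ) 1) (hFx : Tendsto (fun n => Fn n x) atTop (𝓝 (F x)))
    {k p : ℝ} {kn : ℕ → ℝ} (hk : HasDerivAt F k x) (hkn : ∀ n, HasDerivAt (Fn n) (kn n) x)
    (hp : HasDerivAt f p x) (hpos : 0 < F x) :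
    Tendsto kn atTop (𝓝 k) := by
  have hxI : x ∈ Ioc (0:ℝ) 1 := ⟨hx.1, hx.2.le⟩
  have hxc : x ∈ Icc (0:ℝ) 1 := ⟨hx.1.le, hx.2.le⟩
  -- small h
  have sm : ∀ᶠ h in 𝓝[>] (0:ℝ), 0 < h ∧ h < x ∧ x + h < 1 ∧ 0 < F (x - h) := by
    have t1 : Tendsto (fun h : ℝ => F (x - h)) (𝓝[>] 0) (𝓝 (F x)) := by
      have : Tendsto (fun h : ℝ => x - h) (𝓝 0) (𝓝 x) := by
        have : Continuous (fun h : ℝ => x - h) := by fun_prop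
        simpa using this.tendsto 0
      exact hk.continuousAt.tendsto.comp (this.mono_left nhdsWithin_le_nhds)
    have a2 : ∀ᶠ h in 𝓝[>] (0:ℝ), h < x := nhdsWithin_le_nhds (gt_mem_nhds hx.1)
    have a3 : ∀ᶠ h in 𝓝[>] (0:ℝ), h < 1 - x := nhdsWithin_le_nhds (gt_mem_nhds (by linarith [hx.2]))
    filter_upwards [self_mem_nhdsWithin, a2, a3, t1.eventually (lt_mem_nhds hpos)] with h h1 h2 h3 h4
    exact ⟨h1, h2, by linarith, h4⟩
  have hpneg : p ≠ 0 := by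
    have h2 : x < (x+1)/2 := by linarith [hx.2]
    have h3 : (x+1)/2 < 1 := by linarith [hx.2]
    -- slope bound
    have hq := hasDeriv_quot_left hp
    have : p ≤ (f ((x+1)/2) - f x) / ((x+1)/2 - x) := by
      refine le_of_tendsto hq ?_
      filter_upwards [sm] with h ⟨h0, h1, _, _⟩
      have := cvx_three S.cvx (a := x - h) (b := x) (c := (x+1)/2) (by linarith) (by linarith) h2.le h3
      rw [div_le_div_iff₀ h0 (by linarith)]
      nlinarith
    have h4 := S.anti hxI (b := (x+1)/2) ⟨by linarith [hx.1], h3.le⟩ h2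
    have h5 : (f ((x+1)/2) - f x) / ((x+1)/2 - x) < 0 := div_neg_of_neg_of_pos (by linarith) (by linarith)
    linarith
  have hfF : ∀ a ∈ Ioc (0:ℝ) 1, 0 < F a → f (F a) = f a + s := S.eq
  have hFnpos : ∀ᶠ n in atTop, 0 < Fn n x := hFx.eventually (lt_mem_nhds hpos)
  have hfFn : Tendsto (fun n => fn n (Fn n x)) atTop (𝓝 (f (F x))) := by
    rw [S.eq x hxI hpos]
    refine ((hf x hxI).add hs).congr' ?_
    filter_upwards [hFnpos] with n hn using ((Sn n).eq x hxI hn).symm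
  have hFx1 : F x ≤ x := S.le x hxc
  -- strict monotonicity facts
  have hstr : ∀ a ∈ Ioc (0:ℝ) 1, ∀ b ∈ Ioc (0:ℝ) 1, a < b → 0 < F a → F a < F b := by
    intro a ha b hb hab hFa
    have hle := S.mono ⟨ha.1.le, ha.2⟩ ⟨hb.1.le, hb.2⟩ hab.le
    refine lt_of_le_of_ne hle fun he => ?_
    have e1 := S.eq a ha hFa
    have e2 := S.eq b hb (by linarith)
    have := S.anti ha hb hab
    rw [he] at e1; linarith
  have ineqL : ∀ h, 0 < h → h < x → x + h < 1 → 0 < F (x - h) → F (x - h) < F x := by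
    intro h h0 h1 h2 h3
    exact hstr _ ⟨by linarith, by linarith⟩ _ hxI (by linarith) h3
  have ineqR : ∀ h, 0 < h → h < x → x + h < 1 → F x < F (x + h) := by
    intro h h0 h1 h2
    exact hstr _ hxI _ ⟨by linarith, by linarith⟩ (by linarith) hpos
  refine sandwich
    (Ln := fun h n => ((fn n x - fn n (x + h)) / ((x + h) - x)) / ((fn n (F (x - h)) - fn n (Fn n x)) / (Fn n x - F (x - h))))
    (L := fun h => ((f x - f (x + h)) / ((x + h) - x)) / ((f (F (x - h)) - f (F x)) / (F x - F (x - h))))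
    (Un := fun h n => ((fn n (x - h) - fn n x) / (x - (x - h))) / ((fn n (Fn n x) - fn n (F (x + h))) / (F (x + h) - Fn n x)))
    (U := fun h => ((f (x - h) - f x) / (x - (x - h))) / ((f (F x) - f (F (x + h))) / (F (x + h) - F x)))
    ?_ ?_ ?_ ?_
  · filter_upwards [sm] with h ⟨h0, h1, h2, h3⟩
    have i1 := ineqL h h0 h1 h2 h3
    have m1 : F (x - h) ∈ Ioc (0:ℝ) 1 := ⟨h3, by linarith⟩
    have m2 : x + h ∈ Ioc (0:ℝ) 1 := ⟨by linarith, h2.le⟩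
    constructor
    · filter_upwards [hFnpos, hFx.eventually (lt_mem_nhds i1)] with n hn hn2
      have hFn1 := (Sn n).le x hxc
      have hlt : Fn n x < 1 := by linarith [hx.2]
      have st := (Sn n).anti m1 ⟨hn, hlt.le⟩ hn2
      have := key_lower (Sn n).cvx hx (hkn n)
        (fun a ha => (Sn n).mono ⟨ha.1.le, by linarith [ha.2, hx.2]⟩ hxc ha.2.le) hn hlt
        (fun a ha => (Sn n).eq a ⟨ha.1, by linarith [ha.2, hx.2]⟩) (x2 := x + h) (u1 := F (x - h))
        (by linarith) h2 h3 hn2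
      rwa [div_le_iff₀]
      exact div_pos (by linarith) (by linarith)
    · have st : f (F x) < f (F (x - h)) := S.anti m1 ⟨hpos, by linarith [hx.2]⟩ i1
      refine Tendsto.div (((hf x hxI).sub (hf _ m2)).div_const _)
        (((hf _ m1).sub hfFn).div (hFx.sub_const _) (by linarith)) ?_
      exact (div_pos (by linarith) (by linarith)).ne'
  · filter_upwards [sm] with h ⟨h0, h1, h2, h3⟩
    have i1 := ineqR h h0 h1 h2
    have m2 : x + h ∈ Ioc (0:ℝ) 1 := ⟨by linarith, h2.le⟩
    have m0 : x - h ∈ Ioc (0:ℝ) 1 := ⟨by linarith, by linarith [hx.2]⟩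
    have lt1 : F (x + h) < 1 := by linarith [S.le (x + h) ⟨m2.1.le, m2.2⟩]
    have m1 : F (x + h) ∈ Ioc (0:ℝ) 1 := ⟨by linarith, lt1.le⟩
    constructor
    · filter_upwards [hFnpos, hFx.eventually (gt_mem_nhds i1)] with n hn hn2
      have hFn1 := (Sn n).le x hxc
      have st := (Sn n).anti ⟨hn, by linarith⟩ m1 hn2
      have := key_upper (Sn n).cvx hx (hkn n)
        (fun a ha => (Sn n).mono ⟨ha.1.le, by linarith [ha.2, hx.2]⟩ hxc ha.2.le) hn
        (fun a ha => (Sn n).eq a ⟨ha.1, by linarith [ha.2, hx.2]⟩) (x1 := x - h) (u2 := F (x + h))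
        (by linarith) m0.1 hn2 lt1
      rwa [le_div_iff₀]
      exact div_pos (by linarith) (by linarith)
    · have st : f (F (x + h)) < f (F x) := S.anti ⟨hpos, by linarith [hx.2]⟩ m1 i1
      refine Tendsto.div (((hf _ m0).sub (hf x hxI)).div_const _)
        ((hfFn.sub (hf _ m1)).div (tendsto_const_nhds.sub hFx) (by linarith)) ?_
      exact (div_pos (by linarith) (by linarith)).ne'
  · have t := ((hasDeriv_quot_right hp).div (hasDeriv_quot_left hp) hpneg).mul (hasDeriv_quot_left hk)
    rw [div_self hpneg, one_mul] at t
    refine t.congr' ?_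
    filter_upwards [sm] with h ⟨h0, h1, h2, h3⟩
    have m0 : x - h ∈ Ioc (0:ℝ) 1 := ⟨by linarith, by linarith [hx.2]⟩
    have i1 := ineqL h h0 h1 h2 h3
    rw [S.eq x hxI hpos, S.eq _ m0 h3]
    have st := S.anti m0 hxI (by linarith)
    have e1 : x + h - x = h := by ring
    have e2 : f (x - h) + s - (f x + s) = f (x - h) - f x := by ring
    rw [e1, e2]
    have n1 : F x - F (x - h) ≠ 0 := by linarith
    have n2 : f (x - h) - f x ≠ 0 := by linarith
    have n3 : f x - f (x - h) ≠ 0 := by linarith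
    simp only [Pi.div_apply]
    field_simp
    ring
  · have t := ((hasDeriv_quot_left hp).div (hasDeriv_quot_right hp) hpneg).mul (hasDeriv_quot_right hk)
    rw [div_self hpneg, one_mul] at t
    refine t.congr' ?_
    filter_upwards [sm] with h ⟨h0, h1, h2, h3⟩
    have m0 : x + h ∈ Ioc (0:ℝ) 1 := ⟨by linarith, by linarith [hx.2]⟩
    have i1 := ineqR h h0 h1 h2
    rw [S.eq x hxI hpos, S.eq _ m0 (by linarith)]
    have st := S.anti hxI m0 (by linarith)
    have e1 : x - (x - h) = h := by ring
    have e2 : f x + s - (f (x + h) + s) = f x - f (x + h) := by ring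
    rw [e1, e2]
    have n1 : F (x + h) - F x ≠ 0 := by linarith
    have n2 : f (x + h) - f x ≠ 0 := by linarith
    have n3 : f x - f (x + h) ≠ 0 := by linarith
    simp only [Pi.div_apply]
    field_simp
    ring

lemma sec_zero_case {f F : ℝ → ℝ} {s : ℝ} (S : Sec f F s)
    {fn Fn : ℕ → ℝ → ℝ} {sn : ℕ → ℝ} (Sn : ∀ n, Sec (fn n) (Fn n) (sn n))
    (hf : ∀ a ∈ Ioc (0:ℝ) 1, Tendsto (fun n => fn n a) atTop (𝓝 (f a)))
    (hs : Tendsto sn atTop (𝓝 s))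
    {x : ℝ} (hx : x ∈ Ioo (0:ℝ) 1) (hFx : Tendsto (fun n => Fn n x) atTop (𝓝 (F x)))
    {k : ℝ} {kn : ℕ → ℝ} (hk : HasDerivAt F k x) (hkn : ∀ n, HasDerivAt (Fn n) (kn n) x)
    {x' : ℝ} (hx' : x < x') (hx'1 : x' ≤ 1) (hzero : F x' = 0) :
    Tendsto kn atTop (𝓝 k) := by
  have hxI : x ∈ Ioc (0:ℝ) 1 := ⟨hx.1, hx.2.le⟩
  have hxc : x ∈ Icc (0:ℝ) 1 := ⟨hx.1.le, hx.2.le⟩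
  have hx'I : x' ∈ Ioc (0:ℝ) 1 := ⟨by linarith [hx.1], hx'1⟩
  -- zero derivative when zero on left
  have zd : ∀ {G : ℝ → ℝ} {q t : ℝ} {g : ℝ → ℝ}, Sec g G t → HasDerivAt G q x → G x = 0 → q = 0 := by
    intro G q t g SG hG h0
    have hz : ∀ᶠ a in 𝓝[<] x, G a = 0 := by
      filter_upwards [nhdsWithin_le_nhds (lt_mem_nhds hx.1), self_mem_nhdsWithin] with a ha ha2
      have ha2' : a < x := ha2
      have mem : a ∈ Icc (0:ℝ) 1 := ⟨le_of_lt ha, by linarith [hx.2]⟩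
      exact le_antisymm (h0 ▸ SG.mono mem hxc ha2'.le) (SG.nonneg a mem)
    have a1 : (0:ℝ) ≤ q * 1 := le_of_left_quot hG (by
      filter_upwards [hz] with a ha; rw [ha, h0]; simp)
    have a2 : q * 1 ≤ (0:ℝ) := ge_of_left_quot hG (by
      filter_upwards [hz] with a ha; rw [ha, h0]; simp)
    linarith
  have hFx0 : F x = 0 := le_antisymm (hzero ▸ S.mono hxc ⟨hx'I.1.le, hx'1⟩ hx'.le) (S.nonneg x hxc)
  have hk0 : k = 0 := zd S hk hFx0
  have knn : ∀ n, 0 ≤ kn n := by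
    intro n
    have := le_of_left_quot (A := 0) (B := 1) (hkn n) (by
      filter_upwards [nhdsWithin_le_nhds (lt_mem_nhds hx.1), self_mem_nhdsWithin] with a ha ha2
      have ha2' : a < x := ha2
      have mem : a ∈ Icc (0:ℝ) 1 := ⟨le_of_lt ha, by linarith [hx.2]⟩
      have := (Sn n).mono mem hxc ha2'.le
      linarith)
    linarith
  have hδ : 0 < f x - f x' := by linarith [S.anti hxI hx'I hx']
  have hδv : ∀ v ∈ Ioc (0:ℝ) 1, f x - f x' ≤ f x + s - f v := fun v hv => by
    linarith [S.zero x' hx'I hzero v hv]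
  have hx1 : x / 2 ∈ Ioc (0:ℝ) 1 := ⟨by linarith [hx.1], by linarith [hx.1, hx.2]⟩
  rw [hk0] at *
  have sm : ∀ᶠ v in 𝓝[>] (0:ℝ), 0 < v ∧ v < 1 := by
    filter_upwards [self_mem_nhdsWithin, nhdsWithin_le_nhds (gt_mem_nhds one_pos)] with v a b using ⟨a, b⟩
  set A := (f (x/2) - f x) / (x - x/2) with hA
  have hApos : 0 ≤ A := div_nonneg (by linarith [S.anti hx1 hxI (by linarith [hx.1])]) (by linarith [hx.1])
  have hU0 : Tendsto (fun v => A / ((f x + s - f v) / v)) (𝓝[>] 0) (𝓝 0) := by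
    have b : Tendsto (fun v : ℝ => A / (f x - f x') * v) (𝓝[>] 0) (𝓝 0) := by
      have : Continuous (fun v : ℝ => A / (f x - f x') * v) := by fun_prop
      simpa using (this.tendsto 0).mono_left nhdsWithin_le_nhds
    refine squeeze_zero' ?_ ?_ b
    · filter_upwards [sm] with v ⟨h0, h1⟩
      have := hδv v ⟨h0, h1.le⟩
      exact div_nonneg hApos (div_nonneg (by linarith) h0.le)
    · filter_upwards [sm] with v ⟨h0, h1⟩
      have := hδv v ⟨h0, h1.le⟩
      have e1 : A / ((f x + s - f v) / v) = A * v / (f x + s - f v) := div_div_eq_mul_div _ _ _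
      have e2 : A / (f x - f x') * v = A * v / (f x - f x') := div_mul_eq_mul_div _ _ _
      rw [e1, e2]
      exact div_le_div_of_nonneg_left (mul_nonneg hApos h0.le) hδ this
  refine sandwich (Ln := fun _ _ => 0) (L := fun _ => 0)
    (Un := fun v n => ((fn n (x/2) - fn n x) / (x - x/2)) / ((fn n x + sn n - fn n v) / (v - Fn n x)))
    (U := fun v => A / ((f x + s - f v) / v)) ?_ ?_ tendsto_const_nhds hU0
  · exact Eventually.of_forall fun _ => ⟨Eventually.of_forall knn, tendsto_const_nhds⟩
  · filter_upwards [sm] with v ⟨h0, h1⟩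
    have hv : v ∈ Ioc (0:ℝ) 1 := ⟨h0, h1.le⟩
    have d1 := hδv v hv
    have tden : Tendsto (fun n => fn n x + sn n - fn n v) atTop (𝓝 (f x + s - f v)) :=
      ((hf x hxI).add hs).sub (hf v hv)
    constructor
    · filter_upwards [tden.eventually (lt_mem_nhds (show (0:ℝ) < _ by linarith)),
        hFx.eventually (gt_mem_nhds (show F x < v by linarith))] with n g1 g2
      have dpos : 0 < (fn n x + sn n - fn n v) / (v - Fn n x) := div_pos g1 (by linarith)
      rw [le_div_iff₀ dpos]
      rcases ((Sn n).nonneg x hxc).eq_or_lt with hz | hz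
      · rw [zd (Sn n) (hkn n) hz.symm, zero_mul]
        exact div_nonneg (by linarith [(Sn n).anti hx1 hxI (by linarith [hx.1])]) (by linarith [hx.1])
      · have := key_upper (Sn n).cvx hx (hkn n)
          (fun a ha => (Sn n).mono ⟨ha.1.le, by linarith [ha.2, hx.2]⟩ hxc ha.2.le) hz
          (fun a ha => (Sn n).eq a ⟨ha.1, by linarith [ha.2, hx.2]⟩) (x1 := x / 2) (u2 := v)
          (by linarith [hx.1]) hx1.1 g2 h1
        rwa [(Sn n).eq x hxI hz] at this
    · refine Tendsto.div (((hf _ hx1).sub (hf x hxI)).div_const _) ?_ ?_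
      · have := tden.div (tendsto_const_nhds.sub hFx : Tendsto (fun n => v - Fn n x) _ _) (by linarith)
        rw [hFx0, sub_zero] at this
        exact this
      · exact (div_pos (by linarith) h0).ne'

lemma evalPsi_nonneg {d : ℕ} {ψ : ℝ → ℝ} {φ : ℝ → ℝ≥0∞} (G : IsGenerator d ψ φ) (s : ℝ≥0∞) :
    0 ≤ evalPsi ψ s := by
  unfold evalPsi; split_ifs
  · exact le_rfl
  · exact G.nonneg _ ENNReal.toReal_nonneg

lemma evalPsi_anti {d : ℕ} {ψ : ℝ → ℝ} {φ : ℝ → ℝ≥0∞} (G : IsGenerator d ψ φ) {s t : ℝ≥0∞}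
    (h : s ≤ t) : evalPsi ψ t ≤ evalPsi ψ s := by
  by_cases ht : t = ∞
  · simp only [evalPsi, ht, if_true]; exact evalPsi_nonneg G s
  · have hs : s ≠ ∞ := ne_top_of_le_ne_top ht h
    simp only [evalPsi, ht, hs, if_false]
    exact G.antitoneOn ENNReal.toReal_nonneg ENNReal.toReal_nonneg (ENNReal.toReal_mono ht h)

lemma evalPsi_zero {d : ℕ} {ψ : ℝ → ℝ} {φ : ℝ → ℝ≥0∞} (G : IsGenerator d ψ φ) :
    evalPsi ψ 0 = 1 := by simp [evalPsi, G.at_zero]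

lemma evalPsi_le_one {d : ℕ} {ψ : ℝ → ℝ} {φ : ℝ → ℝ≥0∞} (G : IsGenerator d ψ φ) (s : ℝ≥0∞) :
    evalPsi ψ s ≤ 1 := by
  rw [← evalPsi_zero G]; exact evalPsi_anti G (zero_le)

lemma evalPsi_strict {d : ℕ} {ψ : ℝ → ℝ} {φ : ℝ → ℝ≥0∞} (G : IsGenerator d ψ φ) {s t : ℝ≥0∞}
    (h : s < t) (hs : 0 < evalPsi ψ s) : evalPsi ψ t < evalPsi ψ s := by
  by_cases ht : t = ∞
  · simpa only [evalPsi, ht, if_true] using hs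
  · have hs' : s ≠ ∞ := ne_top_of_lt h
    rcases (evalPsi_nonneg G t).eq_or_lt with h0 | h0
    · rwa [← h0]
    · simp only [evalPsi, if_neg ht, if_neg hs'] at h0 ⊢
      exact G.strict_anti _ _ ENNReal.toReal_nonneg ((ENNReal.toReal_lt_toReal hs' ht).2 h) h0

lemma evalPsi_ge_imp {d : ℕ} {ψ : ℝ → ℝ} {φ : ℝ → ℝ≥0∞} (G : IsGenerator d ψ φ) {s t : ℝ≥0∞}
    (h : evalPsi ψ s < evalPsi ψ t) : t < s := by
  by_contra! hc
  exact absurd (evalPsi_anti G hc) (not_le.2 h)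

/-- `φ (ψ s) = s` when `ψ s > 0` -/
lemma phi_evalPsi {d : ℕ} {ψ : ℝ → ℝ} {φ : ℝ → ℝ≥0∞} (G : IsGenerator d ψ φ) {s : ℝ≥0∞}
    (hs : 0 < evalPsi ψ s) : φ (evalPsi ψ s) = s := by
  have h := G.psi_phi _ hs (evalPsi_le_one G s)
  rcases lt_trichotomy (φ (evalPsi ψ s)) s with h1 | h1 | h1
  · exact absurd (evalPsi_strict G h1 (by rw [h]; exact hs)) (by rw [h]; exact lt_irrefl _)
  · exact h1
  · exact absurd (evalPsi_strict G h1 hs) (by rw [h]; exact lt_irrefl _)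

lemma evalPsi_phi_zero_add {d : ℕ} {ψ : ℝ → ℝ} {φ : ℝ → ℝ≥0∞} (G : IsGenerator d ψ φ) (t : ℝ≥0∞) :
    evalPsi ψ (φ 0 + t) = 0 := by
  by_contra hne
  have hpos : 0 < evalPsi ψ (φ 0 + t) := lt_of_le_of_ne (evalPsi_nonneg G _) (Ne.symm hne)
  have hpos0 : 0 < evalPsi ψ (φ 0) := hpos.trans_le (evalPsi_anti G le_self_add)
  have hfin : φ 0 ≠ ∞ := by
    intro h; rw [h] at hpos0; simp [evalPsi] at hpos0
  -- continuity: ψ positive slightly beyond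
  have hp : 0 < ψ (φ 0).toReal := by simpa [evalPsi, hfin] using hpos0
  have hc : ContinuousWithinAt ψ (Ici 0) (φ 0).toReal := G.continuousOn _ ENNReal.toReal_nonneg
  have hc' : ∀ᶠ z in 𝓝[>] (φ 0).toReal, 0 < ψ z := by
    have := hc.tendsto.eventually (lt_mem_nhds hp)
    exact nhdsWithin_mono _ (fun z hz => le_trans ENNReal.toReal_nonneg (le_of_lt hz)) this
  obtain ⟨z, hz1, hz2⟩ := (hc'.and self_mem_nhdsWithin).exists
  have hz2' : (φ 0).toReal < z := hz2
  have hz0 : 0 ≤ z := le_trans ENNReal.toReal_nonneg hz2'.le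
  have : φ 0 < ENNReal.ofReal z := (ENNReal.lt_ofReal_iff_toReal_lt hfin).2 hz2'
  rw [G.phi_zero, sInf_lt_iff] at this
  obtain ⟨w, hw, hwz⟩ := this
  have h1 : evalPsi ψ (ENNReal.ofReal z) ≤ evalPsi ψ w := evalPsi_anti G hwz.le
  rw [show evalPsi ψ w = 0 from hw] at h1
  simp [evalPsi, ENNReal.toReal_ofReal hz0] at h1
  linarith

lemma evalPsi_phi {d : ℕ} {ψ : ℝ → ℝ} {φ : ℝ → ℝ≥0∞} (G : IsGenerator d ψ φ) {t : ℝ}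
    (ht : t ∈ Icc (0:ℝ) 1) : evalPsi ψ (φ t) = t := by
  rcases ht.1.eq_or_lt with h | h
  · rw [← h]; simpa using evalPsi_phi_zero_add G 0
  · exact G.psi_phi t h ht.2

lemma evalPsi_assoc {d : ℕ} {ψ : ℝ → ℝ} {φ : ℝ → ℝ≥0∞} (G : IsGenerator d ψ φ) (s t : ℝ≥0∞) :
    evalPsi ψ (φ (evalPsi ψ s) + t) = evalPsi ψ (s + t) := by
  rcases (evalPsi_nonneg G s).eq_or_lt with h | h
  · rw [← h, evalPsi_phi_zero_add G]
    refine le_antisymm (evalPsi_nonneg G _) ?_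
    rw [h]; exact evalPsi_anti G le_self_add
  · rw [phi_evalPsi G h]

/-- real valued pseudo-inverse -/
def fR (φ : ℝ → ℝ≥0∞) (t : ℝ) : ℝ := (φ t).toReal

lemma phi_lt {d : ℕ} {ψ : ℝ → ℝ} {φ : ℝ → ℝ≥0∞} (G : IsGenerator d ψ φ) {a b : ℝ}
    (ha : 0 ≤ a) (hab : a < b) (hb : b ≤ 1) : φ b < φ a := by
  apply evalPsi_ge_imp G
  rw [evalPsi_phi G ⟨ha, by linarith⟩, evalPsi_phi G ⟨by linarith, hb⟩]; exact hab

lemma fR_strictAnti {d : ℕ} {ψ : ℝ → ℝ} {φ : ℝ → ℝ≥0∞} (G : IsGenerator d ψ φ) :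
    StrictAntiOn (fR φ) (Ioc 0 1) := by
  intro a ha b hb hab
  exact (ENNReal.toReal_lt_toReal (G.phi_finite b hb.1) (G.phi_finite a ha.1)).2
    (phi_lt G ha.1.le hab hb.2)

lemma fR_one {d : ℕ} {ψ : ℝ → ℝ} {φ : ℝ → ℝ≥0∞} (G : IsGenerator d ψ φ) : fR φ 1 = 0 := by
  simp [fR, G.phi_one]

lemma fR_pos {d : ℕ} {ψ : ℝ → ℝ} {φ : ℝ → ℝ≥0∞} (G : IsGenerator d ψ φ) {a : ℝ}
    (ha : a ∈ Ioo (0:ℝ) 1) : 0 < fR φ a := by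
  rw [← fR_one G]
  exact fR_strictAnti G ⟨ha.1, ha.2.le⟩ ⟨one_pos, le_rfl⟩ ha.2

lemma psi_fR {d : ℕ} {ψ : ℝ → ℝ} {φ : ℝ → ℝ≥0∞} (G : IsGenerator d ψ φ) {a : ℝ}
    (ha : a ∈ Ioc (0:ℝ) 1) : ψ (fR φ a) = a := by
  have := G.psi_phi a ha.1 ha.2
  simpa [evalPsi, G.phi_finite a ha.1, fR] using this

lemma fR_psi {d : ℕ} {ψ : ℝ → ℝ} {φ : ℝ → ℝ≥0∞} (G : IsGenerator d ψ φ) {z : ℝ}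
    (hz : 0 ≤ z) (h : 0 < ψ z) : fR φ (ψ z) = z := by
  have e : evalPsi ψ (ENNReal.ofReal z) = ψ z := by simp [evalPsi, ENNReal.toReal_ofReal hz]
  have := phi_evalPsi G (s := ENNReal.ofReal z) (by rw [e]; exact h)
  rw [e] at this
  simp [fR, this, ENNReal.toReal_ofReal hz]

lemma psi_convex {d : ℕ} (hd : 2 ≤ d) {ψ : ℝ → ℝ} {φ : ℝ → ℝ≥0∞} (G : IsGenerator d ψ φ) :
    ConvexOn ℝ (Ioi 0) ψ := by
  have hcont : ContinuousOn ψ (Ioi 0) := G.continuousOn.mono Ioi_subset_Ici_self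
  obtain ⟨e, rfl⟩ : ∃ e, d = e + 2 := ⟨d - 2, by omega⟩
  have hsub : e + 2 - 2 = e := by omega
  rcases e with _ | _ | e
  · have := G.top_convex
    simpa using this
  · have hm := G.top_antitone
    refine MonotoneOn.convexOn_of_deriv (convex_Ioi 0) hcont ?_ ?_
    · rw [interior_Ioi]
      intro z hz
      exact ((G.smooth z hz).differentiableAt (by simp)).differentiableWithinAt
    · rw [interior_Ioi]
      intro a ha b hb hab
      have := hm ha hb hab
      simpa using this
  · have hsm : ∀ z : ℝ, 0 < z → ContDiffAt ℝ 2 ψ z := fun z hz =>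
      (G.smooth z hz).of_le (by
        rw [hsub]
        have : ((2 : ℕ) : ℕ∞) ≤ ((e + 1 + 1 : ℕ) : ℕ∞) := by exact_mod_cast (by omega : 2 ≤ e + 1 + 1)
        exact WithTop.coe_le_coe.2 this)
    have hder : ∀ z : ℝ, 0 < z → DifferentiableAt ℝ (deriv ψ) z := fun z hz => by
      have h1 : ContDiffAt ℝ 1 (deriv ψ) z := (hsm z hz).derivWithin (by norm_num)
      exact h1.differentiableAt (by simp)
    refine convexOn_of_deriv2_nonneg (convex_Ioi 0) hcont ?_ ?_ ?_
    · rw [interior_Ioi]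
      intro z hz
      exact ((hsm z hz).differentiableAt (by simp)).differentiableWithinAt
    · rw [interior_Ioi]
      intro z hz
      exact (hder z hz).differentiableWithinAt
    · rw [interior_Ioi]
      intro z hz
      have := G.alt_sign 2 (by omega) z hz
      simpa [iteratedDeriv_eq_iterate] using this

lemma fR_convex {d : ℕ} (hd : 2 ≤ d) {ψ : ℝ → ℝ} {φ : ℝ → ℝ≥0∞} (G : IsGenerator d ψ φ) :
    ConvexOn ℝ (Ioo 0 1) (fR φ) := by
  refine ⟨convex_Ioo 0 1, ?_⟩
  intro a ha b hb p q hp hq hpq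
  have hfa := fR_pos G ha
  have hfb := fR_pos G hb
  have hc := (psi_convex hd G).2 (x := fR φ a) hfa (y := fR φ b) hfb hp hq hpq
  have hm : p • a + q • b ∈ Ioo (0:ℝ) 1 := convex_Ioo (0:ℝ) 1 ha hb hp hq hpq
  have hM : p • fR φ a + q • fR φ b ∈ Ioi (0:ℝ) := convex_Ioi (0:ℝ) hfa hfb hp hq hpq
  rw [psi_fR G ⟨ha.1, ha.2.le⟩, psi_fR G ⟨hb.1, hb.2.le⟩] at hc
  by_contra! hlt
  have h1 := psi_fR G ⟨hm.1, hm.2.le⟩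
  have h2 := G.strict_anti _ _ (le_of_lt hM) hlt (by rw [h1]; exact hm.1)
  rw [h1] at h2
  linarith

lemma copFun2_sum_fin {d m : ℕ} {ψ : ℝ → ℝ} {φ : ℝ → ℝ≥0∞} (G : IsGenerator d ψ φ)
    {y : Fin m → ℝ} (hy : ∀ j, 0 < y j) : ∑ j, φ (y j) ≠ ∞ := by
  simp only [ne_eq, ENNReal.sum_eq_top, not_exists]
  intro j hj
  exact G.phi_finite _ (hy j) hj.2

lemma gen_sec {d : ℕ} (hd : 2 ≤ d) {ψ : ℝ → ℝ} {φ : ℝ → ℝ≥0∞} (G : IsGenerator d ψ φ)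
    {y : Fin (d-1) → ℝ} (hy : ∀ j, 0 < y j) {c : ℝ} (hc : 0 < c) :
    Sec (fun t => fR φ t / c) (fun a => copFun2 d ψ φ (a, y)) (∑ j, fR φ (y j) / c) := by
  have hfin := copFun2_sum_fin G hy
  have hsum : (∑ j, φ (y j)).toReal = ∑ j, fR φ (y j) := by
    rw [ENNReal.toReal_sum]
    · rfl
    · intro j _; exact G.phi_finite _ (hy j)
  refine ⟨?_, ?_, ?_, ?_, ?_, ?_, ?_⟩
  · have := (fR_convex hd G).smul (c := c⁻¹) (by positivity)
    refine this.congr ?_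
    intro t _; simp [div_eq_inv_mul]
  · intro a ha b hb hab
    exact div_lt_div_of_pos_right (fR_strictAnti G ha hb hab) hc
  · intro a ha b hb hab
    apply evalPsi_anti G
    rcases hab.eq_or_lt with rfl | h
    · exact le_rfl
    · exact add_le_add_left (phi_lt G ha.1 h hb.2).le _
  · intro a ha; exact evalPsi_nonneg G _
  · intro a ha
    calc evalPsi ψ (φ a + _) ≤ evalPsi ψ (φ a) := evalPsi_anti G le_self_add
      _ = a := evalPsi_phi G ha
  · intro a ha hpos
    have : φ (copFun2 d ψ φ (a, y)) = φ a + ∑ j, φ (y j) := phi_evalPsi G hpos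
    simp only [fR, this]
    rw [ENNReal.toReal_add (G.phi_finite a ha.1) hfin, hsum, ← Finset.sum_div, add_div]
    rfl
  · intro a ha hz v hv
    rw [← Finset.sum_div, ← add_div]
    apply div_le_div_of_nonneg_right _ hc.le
    have : φ v < φ a + ∑ j, φ (y j) := by
      apply evalPsi_ge_imp G
      rw [G.psi_phi v hv.1 hv.2]
      exact lt_of_eq_of_lt hz hv.1
    have h2 := ENNReal.toReal_mono (by simp [G.phi_finite a ha.1, hfin]) this.le
    rw [ENNReal.toReal_add (G.phi_finite a ha.1) hfin, hsum] at h2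
    exact h2

lemma copFun2_zero {d : ℕ} {ψ : ℝ → ℝ} {φ : ℝ → ℝ≥0∞} (G : IsGenerator d ψ φ)
    {y : Fin (d-1) → ℝ} {j : Fin (d-1)} (hy : y j = 0) (a : ℝ) : copFun2 d ψ φ (a, y) = 0 := by
  refine le_antisymm ?_ (evalPsi_nonneg G _)
  rw [← evalPsi_phi_zero_add G 0, add_zero]
  apply evalPsi_anti G
  calc φ 0 = φ (y j) := by rw [hy]
    _ ≤ ∑ j, φ (y j) := Finset.single_le_sum (f := fun j => φ (y j)) (fun _ _ => zero_le) (Finset.mem_univ j)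
    _ ≤ _ := le_add_self

lemma copFun2_one_right {d : ℕ} {ψ : ℝ → ℝ} {φ : ℝ → ℝ≥0∞} (G : IsGenerator d ψ φ)
    {a : ℝ} (ha : a ∈ Icc (0:ℝ) 1) : copFun2 d ψ φ (a, fun _ => 1) = a := by
  simp [copFun2, G.phi_one, evalPsi_phi G ha]

lemma copFun2_two {d : ℕ} {ψ : ℝ → ℝ} {φ : ℝ → ℝ≥0∞} (G : IsGenerator d ψ φ)
    (a : ℝ) (j : Fin (d-1)) (v : ℝ) :
    copFun2 d ψ φ (a, Function.update (fun _ => 1) j v) = evalPsi ψ (φ a + φ v) := by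
  unfold copFun2
  congr 2
  rw [Finset.sum_eq_single j]
  · simp
  · intro b _ hb; simp [Function.update_of_ne hb, G.phi_one]
  · simp

lemma update_mem_cube {m : ℕ} (j : Fin m) {v : ℝ} (hv : v ∈ Icc (0:ℝ) 1) :
    Function.update (fun _ => (1:ℝ)) j v ∈ unitCube m := by
  intro i
  by_cases h : i = j
  · subst h; simpa using hv
  · simp [Function.update_of_ne h]

/-- convergence of iterated diagonal sections -/
lemma iter_tendsto {d : ℕ} (hd : 2 ≤ d)
    {ψ : ℝ → ℝ} {φ : ℝ → ℝ≥0∞} (G : IsGenerator d ψ φ)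
    {ψn : ℕ → ℝ → ℝ} {φn : ℕ → ℝ → ℝ≥0∞} (Gn : ∀ n, IsGenerator d (ψn n) (φn n))
    (hlip : ∀ n, ∀ y ∈ unitCube (d-1), ∀ a ∈ Icc (0:ℝ) 1, ∀ b ∈ Icc (0:ℝ) 1,
      |copFun2 d (ψn n) (φn n) (a, y) - copFun2 d (ψn n) (φn n) (b, y)| ≤ |a - b|)
    (hp : ∀ p ∈ (Icc (0:ℝ) 1) ×ˢ unitCube (d - 1),
        Tendsto (fun n => copFun2 d (ψn n) (φn n) p) atTop (nhds (copFun2 d ψ φ p)))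
    {r : ℝ} (hr : r ∈ Icc (0:ℝ) 1) (k : ℕ) :
    Tendsto (fun n => evalPsi (ψn n) (k * φn n r)) atTop (𝓝 (evalPsi ψ (k * φ r))) := by
  have j : Fin (d-1) := ⟨0, by omega⟩
  induction k with
  | zero =>
    simp only [Nat.cast_zero, zero_mul, evalPsi_zero G, fun n => evalPsi_zero (Gn n)]
    exact tendsto_const_nhds
  | succ k ih =>
    have e : evalPsi ψ ((k+1 : ℕ) * φ r) = copFun2 d ψ φ (evalPsi ψ (k * φ r), Function.update (fun _ => 1) j r) := by
      rw [copFun2_two G, evalPsi_assoc G]; push_cast; rw [add_mul, one_mul]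
    have en : ∀ n, evalPsi (ψn n) ((k+1 : ℕ) * φn n r) = copFun2 d (ψn n) (φn n) (evalPsi (ψn n) (k * φn n r), Function.update (fun _ => 1) j r) := by
      intro n
      rw [copFun2_two (Gn n), evalPsi_assoc (Gn n)]; push_cast; rw [add_mul, one_mul]
    simp only [e, en]
    have hm := update_mem_cube j hr
    have mT : evalPsi ψ (k * φ r) ∈ Icc (0:ℝ) 1 := ⟨evalPsi_nonneg G _, evalPsi_le_one G _⟩
    have t1 := hp (evalPsi ψ (k * φ r), Function.update (fun _ => 1) j r) ⟨mT, hm⟩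
    have t2 : Tendsto (fun n => copFun2 d (ψn n) (φn n) (evalPsi (ψn n) (k * φn n r), Function.update (fun _ => 1) j r)
        - copFun2 d (ψn n) (φn n) (evalPsi ψ (k * φ r), Function.update (fun _ => 1) j r)) atTop (𝓝 0) := by
      have t3 : Tendsto (fun n => |evalPsi (ψn n) (k * φn n r) - evalPsi ψ (k * φ r)|) atTop (𝓝 0) := by
        have := (ih.sub_const (evalPsi ψ (k * φ r))).abs
        simpa using this
      refine squeeze_zero_norm (fun n => ?_) t3
      exact hlip n _ hm _ ⟨evalPsi_nonneg (Gn n) _, evalPsi_le_one (Gn n) _⟩ _ mT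
    have := t2.add t1
    simpa using this

lemma ratio_aux {d : ℕ} (hd : 2 ≤ d)
    {ψ : ℝ → ℝ} {φ : ℝ → ℝ≥0∞} (G : IsGenerator d ψ φ)
    {ψn : ℕ → ℝ → ℝ} {φn : ℕ → ℝ → ℝ≥0∞} (Gn : ∀ n, IsGenerator d (ψn n) (φn n))
    (hlip : ∀ n, ∀ y ∈ unitCube (d-1), ∀ a ∈ Icc (0:ℝ) 1, ∀ b ∈ Icc (0:ℝ) 1,
      |copFun2 d (ψn n) (φn n) (a, y) - copFun2 d (ψn n) (φn n) (b, y)| ≤ |a - b|)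
    (hp : ∀ p ∈ (Icc (0:ℝ) 1) ×ˢ unitCube (d - 1),
        Tendsto (fun n => copFun2 d (ψn n) (φn n) p) atTop (nhds (copFun2 d ψ φ p)))
    {a b c : ℝ} (ha : a ∈ Ioo (0:ℝ) 1) (hb : b ∈ Ioo (0:ℝ) 1) (hc : 0 < c)
    (h : fR φ a < c * fR φ b) : ∀ᶠ n in atTop, fR (φn n) a ≤ c * fR (φn n) b := by
  have hfa := fR_pos G ha
  have hfb := fR_pos G hb
  -- choose δ
  set δ := min ((c * fR φ b - fR φ a) / (c + 1) / 2) (fR φ b / 2) with hδ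
  have hδ0 : 0 < δ := by
    apply lt_min
    · have : 0 < c * fR φ b - fR φ a := by linarith
      positivity
    · linarith
  have hδ1 : δ * (c + 1) < c * fR φ b - fR φ a := by
    have : δ ≤ (c * fR φ b - fR φ a) / (c + 1) / 2 := min_le_left _ _
    have h2 : (c * fR φ b - fR φ a) / (c + 1) / 2 * (c + 1) = (c * fR φ b - fR φ a) / 2 := by
      field_simp
    nlinarith
  have hδ2 : δ < fR φ b := by
    have : δ ≤ fR φ b / 2 := min_le_right _ _
    linarith
  set r := ψ δ with hr
  have hrb : b < r := by
    have := G.strict_anti δ (fR φ b) hδ0.le hδ2 (by rw [psi_fR G ⟨hb.1, hb.2.le⟩]; exact hb.1)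
    rwa [psi_fR G ⟨hb.1, hb.2.le⟩] at this
  have hr0 : 0 < r := hb.1.trans hrb
  have hr1 : r < 1 := by
    have := G.strict_anti 0 δ le_rfl hδ0 hr0
    rwa [G.at_zero] at this
  have hfr : fR φ r = δ := fR_psi G hδ0.le hr0
  have hrI : r ∈ Icc (0:ℝ) 1 := ⟨hr0.le, hr1.le⟩
  -- multiples
  have mul_fR : ∀ (ψ' : ℝ → ℝ) (φ' : ℝ → ℝ≥0∞), IsGenerator d ψ' φ' → ∀ k : ℕ,
      ((k : ℝ≥0∞) * φ' r).toReal = k * fR φ' r := by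
    intro ψ' φ' _ k; simp [fR]
  have mul_fin : ∀ (ψ' : ℝ → ℝ) (φ' : ℝ → ℝ≥0∞), IsGenerator d ψ' φ' → ∀ k : ℕ,
      ((k : ℝ≥0∞) * φ' r) ≠ ∞ := by
    intro ψ' φ' G' k
    exact ENNReal.mul_ne_top (by simp) (G'.phi_finite r hr0)
  have low : ∀ k : ℕ, ∀ t ∈ Ioo (0:ℝ) 1, k * δ < fR φ t → ∀ᶠ n in atTop, k * fR (φn n) r < fR (φn n) t := by
    intro k t ht hk
    have hfin := G.phi_finite t ht.1
    have h1 : (k : ℝ≥0∞) * φ r < φ t := by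
      rw [← ENNReal.toReal_lt_toReal (mul_fin _ _ G k) hfin, mul_fR _ _ G, hfr]; exact hk
    have e1 := evalPsi_phi G (t := t) ⟨ht.1.le, ht.2.le⟩
    have h2 : t < evalPsi ψ (k * φ r) := by
      have hle := evalPsi_anti G h1.le
      have := evalPsi_strict G h1 (by rw [e1] at hle; linarith [ht.1])
      rwa [e1] at this
    filter_upwards [(iter_tendsto hd G Gn hlip hp hrI k).eventually (lt_mem_nhds h2)] with n hn
    rw [← mul_fR _ _ (Gn n)]
    refine (ENNReal.toReal_lt_toReal (mul_fin _ _ (Gn n) k) ((Gn n).phi_finite t ht.1)).2 ?_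
    apply evalPsi_ge_imp (Gn n)
    rwa [evalPsi_phi (Gn n) ⟨ht.1.le, ht.2.le⟩]
  have upp : ∀ k : ℕ, ∀ t ∈ Ioo (0:ℝ) 1, fR φ t < k * δ → ∀ᶠ n in atTop, fR (φn n) t < k * fR (φn n) r := by
    intro k t ht hk
    have hfin := G.phi_finite t ht.1
    have h1 : φ t < (k : ℝ≥0∞) * φ r := by
      rw [← ENNReal.toReal_lt_toReal hfin (mul_fin _ _ G k), mul_fR _ _ G, hfr]; exact hk
    have e1 := evalPsi_phi G (t := t) ⟨ht.1.le, ht.2.le⟩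
    have h2 : evalPsi ψ (k * φ r) < t := by
      have := evalPsi_strict G h1 (by rw [e1]; exact ht.1)
      rwa [e1] at this
    filter_upwards [(iter_tendsto hd G Gn hlip hp hrI k).eventually (gt_mem_nhds h2)] with n hn
    rw [← mul_fR _ _ (Gn n)]
    refine (ENNReal.toReal_lt_toReal ((Gn n).phi_finite t ht.1) (mul_fin _ _ (Gn n) k)).2 ?_
    apply evalPsi_ge_imp (Gn n)
    rwa [evalPsi_phi (Gn n) ⟨ht.1.le, ht.2.le⟩]
  -- choose j, k
  obtain ⟨j, hj1, hj2⟩ : ∃ j : ℕ, j * δ < fR φ b ∧ fR φ b ≤ (j + 1) * δ := by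
    have hpos : 0 < ⌈fR φ b / δ⌉₊ := Nat.ceil_pos.2 (by positivity)
    refine ⟨⌈fR φ b / δ⌉₊ - 1, ?_, ?_⟩
    · rw [← lt_div_iff₀ hδ0]
      exact Nat.lt_ceil.1 (by omega)
    · have : ((⌈fR φ b / δ⌉₊ - 1 : ℕ) : ℝ) + 1 = ⌈fR φ b / δ⌉₊ := by
        rw [← Nat.cast_succ]; congr 1; omega
      rw [this, ← div_le_iff₀ hδ0]
      exact Nat.le_ceil _
  have hk1 : (⌊c * j⌋₊ : ℝ) ≤ c * j := Nat.floor_le (by positivity)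
  have hk2 : c * j < ⌊c * j⌋₊ + 1 := Nat.lt_floor_add_one _
  have hk3 : fR φ a < ⌊c * j⌋₊ * δ := by
    have : (c * j - 1) * δ ≤ ⌊c * j⌋₊ * δ := by
      apply mul_le_mul_of_nonneg_right _ hδ0.le; linarith
    nlinarith
  filter_upwards [low j b hb hj1, upp _ a ha hk3] with n h1 h2
  have hrn := fR_pos (Gn n) (a := r) ⟨hr0, hr1⟩
  nlinarith

lemma ratio_tendsto {d : ℕ} (hd : 2 ≤ d)
    {ψ : ℝ → ℝ} {φ : ℝ → ℝ≥0∞} (G : IsGenerator d ψ φ)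
    {ψn : ℕ → ℝ → ℝ} {φn : ℕ → ℝ → ℝ≥0∞} (Gn : ∀ n, IsGenerator d (ψn n) (φn n))
    (hlip : ∀ n, ∀ y ∈ unitCube (d-1), ∀ a ∈ Icc (0:ℝ) 1, ∀ b ∈ Icc (0:ℝ) 1,
      |copFun2 d (ψn n) (φn n) (a, y) - copFun2 d (ψn n) (φn n) (b, y)| ≤ |a - b|)
    (hp : ∀ p ∈ (Icc (0:ℝ) 1) ×ˢ unitCube (d - 1),
        Tendsto (fun n => copFun2 d (ψn n) (φn n) p) atTop (nhds (copFun2 d ψ φ p)))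
    {a : ℝ} (ha : a ∈ Ioc (0:ℝ) 1) :
    Tendsto (fun n => fR (φn n) a / fR (φn n) (1/2)) atTop (𝓝 (fR φ a / fR φ (1/2))) := by
  have hb : (1/2 : ℝ) ∈ Ioo (0:ℝ) 1 := by constructor <;> norm_num
  rcases ha.2.eq_or_lt with rfl | ha1
  · simp only [fR_one G, fun n => fR_one (Gn n), zero_div]; exact tendsto_const_nhds
  have ha' : a ∈ Ioo (0:ℝ) 1 := ⟨ha.1, ha1⟩
  have hfa := fR_pos G ha'
  have hfb := fR_pos G hb
  rw [tendsto_order]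
  constructor
  · intro c hc
    obtain ⟨c', hc1, hc2⟩ := exists_between (max_lt hc (div_pos hfa hfb))
    have hcc : c < c' := (le_max_left _ _).trans_lt hc1
    have hc0 : 0 < c' := (le_max_right _ _).trans_lt hc1
    have : fR φ (1/2) < c'⁻¹ * fR φ a := by
      rw [lt_div_iff₀ hfb] at hc2
      rw [← div_eq_inv_mul, lt_div_iff₀ hc0]; linarith
    filter_upwards [ratio_aux hd G Gn hlip hp hb ha' (inv_pos.2 hc0) this] with n hn
    refine hcc.trans_le ?_
    rw [le_div_iff₀ (fR_pos (Gn n) hb)]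
    rw [← div_eq_inv_mul, le_div_iff₀ hc0] at hn; linarith
  · intro c hc
    obtain ⟨c', hc1, hc2⟩ := exists_between hc
    have hc0 : 0 < c' := (div_pos hfa hfb).trans hc1
    rw [div_lt_iff₀ hfb] at hc1
    filter_upwards [ratio_aux hd G Gn hlip hp ha' hb hc0 hc1] with n hn
    refine lt_of_le_of_lt ?_ hc2
    rwa [div_le_iff₀ (fR_pos (Gn n) hb)]

lemma measurableSet_lowerBox {m : ℕ} (y : Fin m → ℝ) : MeasurableSet (lowerBox y) := by
  have : lowerBox y = ⋂ i, (fun t : Fin m → ℝ => t i) ⁻¹' Iic (y i) := by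
    ext t; simp [lowerBox]
  rw [this]
  exact MeasurableSet.iInter fun i => measurable_pi_apply i measurableSet_Iic

lemma uniform_of_Iic (ν : Measure ℝ) [IsProbabilityMeasure ν]
    (h : ∀ a ∈ Icc (0:ℝ) 1, ν (Iic a) = ENNReal.ofReal a) : ν = volume.restrict (Icc 0 1) := by
  apply Measure.ext_of_Iic
  intro a
  rw [Measure.restrict_apply measurableSet_Iic]
  rcases lt_or_ge a 0 with ha | ha
  · have e : Iic a ∩ Icc (0:ℝ) 1 = ∅ := by
      ext x; simp only [mem_inter_iff, mem_Iic, mem_Icc, mem_empty_iff_false, iff_false]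
      intro hx; linarith [hx.1, hx.2.1]
    rw [e, measure_empty]
    have h0 := h 0 ⟨le_rfl, zero_le_one⟩
    rw [ENNReal.ofReal_zero] at h0
    exact measure_mono_null (Iic_subset_Iic.2 ha.le) h0
  rcases le_or_gt a 1 with ha1 | ha1
  · have e : Iic a ∩ Icc (0:ℝ) 1 = Icc 0 a := by
      ext x; simp only [mem_inter_iff, mem_Iic, mem_Icc]
      constructor
      · rintro ⟨h1, h2, h3⟩; exact ⟨h2, h1⟩
      · rintro ⟨h1, h2⟩; exact ⟨h2, h1, h2.trans ha1⟩
    rw [e, Real.volume_Icc, sub_zero, h a ⟨ha, ha1⟩]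
  · have e : Iic a ∩ Icc (0:ℝ) 1 = Icc 0 1 := by
      apply inter_eq_right.2; intro x hx; exact hx.2.trans ha1.le
    rw [e, Real.volume_Icc, sub_zero, ENNReal.ofReal_one]
    refine le_antisymm prob_le_one ?_
    have h1 := h 1 ⟨zero_le_one, le_rfl⟩
    rw [ENNReal.ofReal_one] at h1
    rw [← h1]; exact measure_mono (Iic_subset_Iic.2 ha1.le)

/-- A copula measure together with a Markov kernel. -/
structure CopM {m : ℕ} (μ : Measure (ℝ × (Fin m → ℝ))) (C : ℝ × (Fin m → ℝ) → ℝ)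
    (K : Kernel ℝ (Fin m → ℝ)) : Prop where
  prob : IsProbabilityMeasure μ
  mark : IsMarkovKernel K
  dis : IsDisintegration μ K
  val : ∀ a ∈ Icc (0:ℝ) 1, ∀ y ∈ unitCube m, μ (Iic a ×ˢ lowerBox y) = ENNReal.ofReal (C (a, y))
  nonneg : ∀ p, 0 ≤ C p
  one_right : ∀ a ∈ Icc (0:ℝ) 1, C (a, fun _ => 1) = a
  marg : ∀ j, ∀ v ∈ Icc (0:ℝ) 1, C (1, Function.update (fun _ => 1) j v) = v

lemma one_mem_cube {m : ℕ} : (fun _ => (1:ℝ)) ∈ unitCube m := fun _ => ⟨zero_le_one, le_rfl⟩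

namespace CopM

variable {m : ℕ} {μ : Measure (ℝ × (Fin m → ℝ))} {C : ℝ × (Fin m → ℝ) → ℝ}
    {K : Kernel ℝ (Fin m → ℝ)}

lemma ae_box (h : CopM μ C K) : ∀ᵐ p ∂μ, p.1 ≤ 1 ∧ ∀ j, p.2 j ≤ 1 := by
  haveI := h.prob
  have h1 := h.val 1 ⟨zero_le_one, le_rfl⟩ _ one_mem_cube
  rw [h.one_right 1 ⟨zero_le_one, le_rfl⟩, ENNReal.ofReal_one] at h1
  have := (prob_compl_eq_zero_iff (μ := μ) (measurableSet_Iic.prod (measurableSet_lowerBox _))).2 h1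
  have h2 := compl_mem_ae_iff.2 this
  rw [compl_compl] at h2
  filter_upwards [h2] with p hp
  exact ⟨hp.1, hp.2⟩

lemma map_fst (h : CopM μ C K) : μ.map Prod.fst = volume.restrict (Icc 0 1) := by
  haveI := h.prob
  haveI : IsProbabilityMeasure (μ.map Prod.fst) := Measure.isProbabilityMeasure_map measurable_fst.aemeasurable
  apply uniform_of_Iic
  intro a ha
  rw [Measure.map_apply measurable_fst measurableSet_Iic, ← h.one_right a ha, ← h.val a ha _ one_mem_cube]
  rw [h.one_right a ha]
  apply measure_congr
  filter_upwards [h.ae_box] with p hp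
  apply propext
  change p.1 ≤ a ↔ (p.1 ≤ a ∧ ∀ j, p.2 j ≤ 1)
  exact ⟨fun q => ⟨q, hp.2⟩, fun q => q.1⟩

lemma map_coord (h : CopM μ C K) (j : Fin m) :
    μ.map (fun p => p.2 j) = volume.restrict (Icc 0 1) := by
  haveI := h.prob
  have hm : Measurable (fun p : ℝ × (Fin m → ℝ) => p.2 j) := by fun_prop
  haveI : IsProbabilityMeasure (μ.map (fun p => p.2 j)) := Measure.isProbabilityMeasure_map hm.aemeasurable
  apply uniform_of_Iic
  intro v hv
  rw [Measure.map_apply hm measurableSet_Iic]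
  have e := h.val 1 ⟨zero_le_one, le_rfl⟩ _ (update_mem_cube j hv)
  rw [h.marg j v hv] at e
  rw [← e]
  apply measure_congr
  filter_upwards [h.ae_box] with p hp
  apply propext
  change p.2 j ≤ v ↔ (p.1 ≤ 1 ∧ ∀ i, p.2 i ≤ Function.update (fun _ => (1:ℝ)) j v i)
  constructor
  · intro q
    refine ⟨hp.1, fun i => ?_⟩
    by_cases hi : i = j
    · subst hi; simpa using q
    · simpa [Function.update_of_ne hi] using hp.2 i
  · intro q; simpa using q.2 j

lemma prod_apply (h : CopM μ C K) {a : ℝ} (ha : a ∈ Icc (0:ℝ) 1) {E : Set (Fin m → ℝ)}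
    (hE : MeasurableSet E) : μ (Iic a ×ˢ E) = ∫⁻ x in Icc 0 a, K x E := by
  rw [h.dis _ (measurableSet_Iic.prod hE), h.map_fst]
  have e : ∀ x, K x (Prod.mk x ⁻¹' (Iic a ×ˢ E)) = (Iic a).indicator (fun x => K x E) x := by
    intro x
    by_cases hx : x ∈ Iic a
    · rw [indicator_of_mem hx, mk_preimage_prod_right hx]
    · rw [indicator_of_notMem hx, mk_preimage_prod_right_eq_empty hx, measure_empty]
  simp_rw [e]
  rw [lintegral_indicator measurableSet_Iic, Measure.restrict_restrict measurableSet_Iic]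
  congr 2
  ext x; simp only [mem_inter_iff, mem_Iic, mem_Icc]
  constructor
  · rintro ⟨h1, h2, h3⟩; exact ⟨h2, h1⟩
  · rintro ⟨h1, h2⟩; exact ⟨h2, h1, h2.trans ha.2⟩

lemma univ_apply (h : CopM μ C K) {E : Set (Fin m → ℝ)}
    (hE : MeasurableSet E) : μ (Prod.snd ⁻¹' E) = ∫⁻ x in Icc 0 1, K x E := by
  rw [← h.prod_apply ⟨zero_le_one, le_rfl⟩ hE]
  apply measure_congr
  filter_upwards [h.ae_box] with p hp
  apply propext
  change p.2 ∈ E ↔ (p.1 ≤ 1 ∧ p.2 ∈ E)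
  exact ⟨fun q => ⟨hp.1, q⟩, fun q => q.2⟩

/-- mass of a coordinate slab -/
lemma coord_apply (h : CopM μ C K) (j : Fin m) {E : Set ℝ} (hE : MeasurableSet E) :
    ∫⁻ x in Icc 0 1, K x {t | t j ∈ E} = volume (E ∩ Icc 0 1) := by
  have hE' : MeasurableSet {t : Fin m → ℝ | t j ∈ E} := measurable_pi_apply j hE
  rw [← h.univ_apply hE', ← Measure.restrict_apply hE, ← h.map_coord j,
    Measure.map_apply (by fun_prop) hE]
  rfl

lemma kernel_meas (K : Kernel ℝ (Fin m → ℝ)) {E : Set (Fin m → ℝ)} (hE : MeasurableSet E) :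
    Measurable (fun x => (K x).real E) := (K.measurable_coe hE).ennreal_toReal

lemma kernel_int (h : IsMarkovKernel K) {E : Set (Fin m → ℝ)} (hE : MeasurableSet E)
    (ν : Measure ℝ) [IsFiniteMeasure ν] : Integrable (fun x => (K x).real E) ν := by
  refine Integrable.of_bound (kernel_meas K hE).aestronglyMeasurable 1 (Eventually.of_forall fun x => ?_)
  rw [Real.norm_of_nonneg measureReal_nonneg]
  exact measureReal_le_one

lemma integral_kernel (h : IsMarkovKernel K) {E : Set (Fin m → ℝ)} (hE : MeasurableSet E)
    (ν : Measure ℝ) : ∫ x, (K x).real E ∂ν = (∫⁻ x, K x E ∂ν).toReal := by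
  apply integral_toReal
  · exact (K.measurable_coe hE).aemeasurable
  · exact Eventually.of_forall fun x => measure_lt_top _ _

lemma C_eq (h : CopM μ C K) {a : ℝ} (ha : a ∈ Icc (0:ℝ) 1) {y : Fin m → ℝ} (hy : y ∈ unitCube m) :
    C (a, y) = ∫ x in Icc 0 a, (K x).real (lowerBox y) := by
  haveI := h.mark
  rw [integral_kernel h.mark (measurableSet_lowerBox y), ← h.prod_apply ha (measurableSet_lowerBox y),
    h.val a ha y hy, ENNReal.toReal_ofReal (h.nonneg _)]

lemma C_eq' (h : CopM μ C K) {a : ℝ} (ha : a ∈ Icc (0:ℝ) 1) {y : Fin m → ℝ} (hy : y ∈ unitCube m) :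
    C (a, y) = ∫ x in (0:ℝ)..a, (K x).real (lowerBox y) := by
  rw [h.C_eq ha hy, intervalIntegral.integral_of_le ha.1, integral_Icc_eq_integral_Ioc]

lemma lip_a (h : CopM μ C K) {y : Fin m → ℝ} (hy : y ∈ unitCube m) {a b : ℝ}
    (ha : a ∈ Icc (0:ℝ) 1) (hb : b ∈ Icc (0:ℝ) 1) : |C (a, y) - C (b, y)| ≤ |a - b| := by
  haveI := h.mark
  rw [h.C_eq' ha hy, h.C_eq' hb hy]
  have hi : ∀ u v : ℝ, IntervalIntegrable (fun x => (K x).real (lowerBox y)) volume u v := fun u v =>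
    ⟨kernel_int h.mark (measurableSet_lowerBox y) _, kernel_int h.mark (measurableSet_lowerBox y) _⟩
  rw [intervalIntegral.integral_interval_sub_left (hi _ _) (hi _ _)]
  have := intervalIntegral.norm_integral_le_of_norm_le_const (a := b) (b := a) (C := 1)
    (f := fun x => (K x).real (lowerBox y)) (fun x _ => by
      rw [Real.norm_of_nonneg measureReal_nonneg]; exact measureReal_le_one)
  simpa using this

/-- derivative of the section -/
lemma ae_deriv (h : CopM μ C K) {y : Fin m → ℝ} (hy : y ∈ unitCube m) :
    ∀ᵐ x, x ∈ Ioo (0:ℝ) 1 → HasDerivAt (fun a => C (a, y)) ((K x).real (lowerBox y)) x := by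
  haveI := h.mark
  have hi : LocallyIntegrable (fun x => (K x).real (lowerBox y)) volume := by
    intro x
    exact ⟨Icc (x-1) (x+1), Icc_mem_nhds (by linarith) (by linarith),
      kernel_int h.mark (measurableSet_lowerBox y) _⟩
  filter_upwards [_root_.LocallyIntegrable.ae_hasDerivAt_integral hi] with x hx hx01
  refine (hx 0).congr_of_eventuallyEq ?_
  filter_upwards [Ioo_mem_nhds hx01.1 hx01.2] with a ha
  exact h.C_eq' ⟨ha.1.le, ha.2.le⟩ hy

/-- Lipschitz in `y`, kernel form -/
lemma lip_y (h : CopM μ C K) {y z : Fin m → ℝ} (hy : y ∈ unitCube m) (hz : z ∈ unitCube m) :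
    ∫ x in Icc (0:ℝ) 1, |(K x).real (lowerBox y) - (K x).real (lowerBox z)| ≤ ∑ j, |y j - z j| := by
  haveI := h.mark
  have hmE : ∀ j, MeasurableSet {t : Fin m → ℝ | t j ∈ uIoc (y j) (z j)} := fun j =>
    measurable_pi_apply j measurableSet_uIoc
  have hb : ∀ x, |(K x).real (lowerBox y) - (K x).real (lowerBox z)| ≤
      ∑ j, (K x).real {t | t j ∈ uIoc (y j) (z j)} := by
    intro x
    refine (abs_measureReal_sub_le_measureReal_symmDiff (measurableSet_lowerBox y).nullMeasurableSet
      (measurableSet_lowerBox z).nullMeasurableSet).trans ?_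
    refine (measureReal_mono ?_).trans (measureReal_iUnion_fintype_le _)
    rintro t (⟨h1, h2⟩ | ⟨h1, h2⟩)
    · simp only [lowerBox, mem_setOf_eq, not_forall, not_le] at h1 h2
      obtain ⟨j, hj⟩ := h2
      exact mem_iUnion.2 ⟨j, by simp only [mem_setOf_eq, mem_uIoc]; exact Or.inr ⟨hj, h1 j⟩⟩
    · simp only [lowerBox, mem_setOf_eq, not_forall, not_le] at h1 h2
      obtain ⟨j, hj⟩ := h2
      exact mem_iUnion.2 ⟨j, by simp only [mem_setOf_eq, mem_uIoc]; exact Or.inl ⟨hj, h1 j⟩⟩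
  calc ∫ x in Icc (0:ℝ) 1, |(K x).real (lowerBox y) - (K x).real (lowerBox z)|
      ≤ ∫ x in Icc (0:ℝ) 1, ∑ j, (K x).real {t | t j ∈ uIoc (y j) (z j)} := by
        apply integral_mono
        · exact ((kernel_int h.mark (measurableSet_lowerBox y) _).sub
            (kernel_int h.mark (measurableSet_lowerBox z) _)).abs
        · exact integrable_finsetSum _ fun j _ => kernel_int h.mark (hmE j) _
        · exact hb
    _ = ∑ j, ∫ x in Icc (0:ℝ) 1, (K x).real {t | t j ∈ uIoc (y j) (z j)} :=
        integral_finsetSum _ fun j _ => kernel_int h.mark (hmE j) _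
    _ ≤ ∑ j, |y j - z j| := by
        refine Finset.sum_le_sum fun j _ => ?_
        rw [integral_kernel h.mark (hmE j), h.coord_apply j measurableSet_uIoc]
        refine ENNReal.toReal_le_of_le_ofReal (abs_nonneg _) ?_
        refine (measure_mono inter_subset_left).trans ?_
        rw [Real.volume_uIoc, abs_sub_comm]

lemma ae_kernel_null (h : CopM μ C K) (j : Fin m) {E : Set ℝ} (hE : MeasurableSet E)
    (h0 : volume (E ∩ Icc 0 1) = 0) : ∀ᵐ x ∂(volume.restrict (Icc (0:ℝ) 1)), K x {t | t j ∈ E} = 0 := by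
  have hE' : MeasurableSet {t : Fin m → ℝ | t j ∈ E} := measurable_pi_apply j hE
  have := h.coord_apply j hE
  rw [h0, lintegral_eq_zero_iff (K.measurable_coe hE')] at this
  exact this

lemma frontier_lowerBox (y : Fin m → ℝ) : frontier (lowerBox y) ⊆ ⋃ j, {t | t j ∈ ({y j} : Set ℝ)} := by
  intro t ht
  have hc : IsClosed (lowerBox y) := by
    have : lowerBox y = ⋂ i, (fun t : Fin m → ℝ => t i) ⁻¹' Iic (y i) := by
      ext t; simp [lowerBox]
    rw [this]
    exact isClosed_iInter fun i => isClosed_Iic.preimage (continuous_apply i)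
  rw [hc.frontier_eq] at ht
  by_contra hcon
  simp only [mem_iUnion, mem_setOf_eq, mem_singleton_iff, not_exists] at hcon
  apply ht.2
  have ho : IsOpen (⋂ i, (fun t : Fin m → ℝ => t i) ⁻¹' Iio (y i)) :=
    isOpen_iInter_of_finite fun i => isOpen_Iio.preimage (continuous_apply i)
  refine mem_interior.2 ⟨_, ?_, ho, ?_⟩
  · intro s hs i
    have := mem_iInter.1 hs i
    exact le_of_lt this
  · exact mem_iInter.2 fun i => lt_of_le_of_ne (ht.1 i) (hcon i)

lemma ae_frontier (h : CopM μ C K) (y : Fin m → ℝ) :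
    ∀ᵐ x ∂(volume.restrict (Icc (0:ℝ) 1)), K x (frontier (lowerBox y)) = 0 := by
  have : ∀ j, ∀ᵐ x ∂(volume.restrict (Icc (0:ℝ) 1)), K x {t | t j ∈ ({y j} : Set ℝ)} = 0 := fun j =>
    h.ae_kernel_null j (measurableSet_singleton _) (measure_mono_null inter_subset_left (by simp))
  filter_upwards [ae_all_iff.2 this] with x hx
  exact measure_mono_null (frontier_lowerBox y) (measure_iUnion_null hx)

/-- clamping -/
lemma ae_clamp (h : CopM μ C K) (y : Fin m → ℝ) :
    ∀ᵐ x ∂(volume.restrict (Icc (0:ℝ) 1)),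
      (K x).real (lowerBox y) = (K x).real (lowerBox fun j => max 0 (min (y j) 1)) := by
  have h1 : ∀ j, ∀ᵐ x ∂(volume.restrict (Icc (0:ℝ) 1)), K x {t | t j ∈ Iic (0:ℝ)} = 0 := fun j =>
    h.ae_kernel_null j measurableSet_Iic (measure_mono_null (t := {0}) (by
      rintro x ⟨h1, h2⟩; exact le_antisymm h1 h2.1) (by simp))
  have h2 : ∀ j, ∀ᵐ x ∂(volume.restrict (Icc (0:ℝ) 1)), K x {t | t j ∈ Ioi (1:ℝ)} = 0 := fun j =>
    h.ae_kernel_null j measurableSet_Ioi (measure_mono_null (t := ∅) (by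
      rintro x ⟨h1, h2⟩; exact absurd h1 (not_lt.2 h2.2)) (by simp))
  filter_upwards [ae_all_iff.2 h1, ae_all_iff.2 h2] with x a1 a2
  refine measureReal_congr ?_
  have b1 : ∀ j, ∀ᵐ t ∂(K x), 0 < t j := fun j => by
    rw [ae_iff]; simpa using a1 j
  have b2 : ∀ j, ∀ᵐ t ∂(K x), t j ≤ 1 := fun j => by
    rw [ae_iff]; simpa using a2 j
  filter_upwards [ae_all_iff.2 b1, ae_all_iff.2 b2] with t c1 c2
  apply propext
  change (∀ i, t i ≤ y i) ↔ (∀ i, t i ≤ max 0 (min (y i) 1))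
  refine forall_congr' fun i => ?_
  constructor
  · intro q; exact le_max_of_le_right (le_min q (c2 i))
  · intro q
    rcases le_max_iff.1 q with q | q
    · exact absurd q (not_le.2 (c1 i))
    · exact (le_min_iff.1 q).1

end CopM

lemma copM_of_gen {d : ℕ} {ψ : ℝ → ℝ} {φ : ℝ → ℝ≥0∞} (G : IsGenerator d ψ φ)
    {μ : Measure (ℝ × (Fin (d - 1) → ℝ))} (hμp : IsProbabilityMeasure μ)
    (hμ : ∀ a ∈ Icc (0:ℝ) 1, ∀ y ∈ unitCube (d - 1),
      μ (Iic a ×ˢ lowerBox y) = ENNReal.ofReal (copFun2 d ψ φ (a, y)))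
    {K : Kernel ℝ (Fin (d - 1) → ℝ)} (hK : IsMarkovKernel K) (hdis : IsDisintegration μ K) :
    CopM μ (copFun2 d ψ φ) K where
  prob := hμp
  mark := hK
  dis := hdis
  val := hμ
  nonneg p := evalPsi_nonneg G _
  one_right a ha := copFun2_one_right G ha
  marg j v hv := by rw [copFun2_two G, G.phi_one, zero_add, evalPsi_phi G hv]

/-- the main lemma: a.e. convergence of the kernels on boxes -/
lemma main_ae {d : ℕ} (hd : 2 ≤ d)
    {ψ : ℝ → ℝ} {φ : ℝ → ℝ≥0∞} (G : IsGenerator d ψ φ)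
    {ψn : ℕ → ℝ → ℝ} {φn : ℕ → ℝ → ℝ≥0∞} (Gn : ∀ n, IsGenerator d (ψn n) (φn n))
    {μ : Measure (ℝ × (Fin (d - 1) → ℝ))} {K : Kernel ℝ (Fin (d - 1) → ℝ)}
    (M : CopM μ (copFun2 d ψ φ) K)
    {μn : ℕ → Measure (ℝ × (Fin (d - 1) → ℝ))} {Kn : ℕ → Kernel ℝ (Fin (d - 1) → ℝ)}
    (Mn : ∀ n, CopM (μn n) (copFun2 d (ψn n) (φn n)) (Kn n))
    (hp : ∀ p ∈ (Icc (0:ℝ) 1) ×ˢ unitCube (d - 1),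
        Tendsto (fun n => copFun2 d (ψn n) (φn n) p) atTop (nhds (copFun2 d ψ φ p)))
    {y : Fin (d - 1) → ℝ} (hy : y ∈ unitCube (d - 1)) :
    ∀ᵐ x ∂(volume.restrict (Icc (0:ℝ) 1)),
      Tendsto (fun n => (Kn n x).real (lowerBox y)) atTop (𝓝 ((K x).real (lowerBox y))) := by
  rw [ae_restrict_iff' measurableSet_Icc]
  have e0 : ∀ᵐ x : ℝ, x ≠ 0 := by simp [ae_iff, measure_singleton]
  have e1 : ∀ᵐ x : ℝ, x ≠ 1 := by simp [ae_iff, measure_singleton]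
  have hDn := ae_all_iff.2 fun n => (Mn n).ae_deriv hy
  by_cases hz : ∃ j, y j = 0
  · obtain ⟨j, hj⟩ := hz
    filter_upwards [M.ae_deriv hy, hDn, e0, e1] with x h1 h2 h3 h4 hx
    have hx' : x ∈ Ioo (0:ℝ) 1 := ⟨lt_of_le_of_ne hx.1 (Ne.symm h3), lt_of_le_of_ne hx.2 h4⟩
    have k0 : (K x).real (lowerBox y) = 0 := by
      have := h1 hx'
      simp only [copFun2_zero G hj] at this
      exact this.unique (hasDerivAt_const _ _)
    have kn0 : ∀ n, (Kn n x).real (lowerBox y) = 0 := by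
      intro n
      have := h2 n hx'
      simp only [copFun2_zero (Gn n) hj] at this
      exact this.unique (hasDerivAt_const _ _)
    simp only [k0, kn0]
    exact tendsto_const_nhds
  · push Not at hz
    have hypos : ∀ j, 0 < y j := fun j => lt_of_le_of_ne (hy j).1 (Ne.symm (hz j))
    have hh : (1/2:ℝ) ∈ Ioo (0:ℝ) 1 := by constructor <;> norm_num
    have S := gen_sec hd G hypos (fR_pos G hh)
    have Sn := fun n => gen_sec hd (Gn n) hypos (fR_pos (Gn n) hh)
    have hlip : ∀ n, ∀ y ∈ unitCube (d-1), ∀ a ∈ Icc (0:ℝ) 1, ∀ b ∈ Icc (0:ℝ) 1,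
        |copFun2 d (ψn n) (φn n) (a,y) - copFun2 d (ψn n) (φn n) (b,y)| ≤ |a-b| :=
      fun n y hy a ha b hb => (Mn n).lip_a hy ha hb
    have hf : ∀ a ∈ Ioc (0:ℝ) 1, Tendsto (fun n => fR (φn n) a / fR (φn n) (1/2)) atTop
        (𝓝 (fR φ a / fR φ (1/2))) := fun a ha => ratio_tendsto hd G Gn hlip hp ha
    have hs : Tendsto (fun n => ∑ j, fR (φn n) (y j) / fR (φn n) (1/2)) atTop
        (𝓝 (∑ j, fR φ (y j) / fR φ (1/2))) :=
      tendsto_finsetSum _ fun j _ => hf (y j) ⟨hypos j, (hy j).2⟩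
    have hmono : MonotoneOn (fun t => - (fR φ t / fR φ (1/2))) (Ioo 0 1) := by
      intro a ha b hb hab
      have := S.anti.antitoneOn ⟨ha.1, ha.2.le⟩ ⟨hb.1, hb.2.le⟩ hab
      simp only at this ⊢
      linarith
    have hbad : ({x | copFun2 d ψ φ (x, y) = 0 ∧ x ∈ Ioo (0:ℝ) 1 ∧
        ∀ x', x < x' → x' ≤ 1 → copFun2 d ψ φ (x', y) ≠ 0}).Subsingleton := by
      rintro a ⟨ha, ha1, ha2⟩ b ⟨hb, hb1, hb2⟩
      rcases lt_trichotomy a b with h | h | h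
      · exact absurd hb (ha2 b h hb1.2.le)
      · exact h
      · exact absurd ha (hb2 a h ha1.2.le)
    have hbad' : ∀ᵐ x : ℝ, ¬ (copFun2 d ψ φ (x, y) = 0 ∧ x ∈ Ioo (0:ℝ) 1 ∧
        ∀ x', x < x' → x' ≤ 1 → copFun2 d ψ φ (x', y) ≠ 0) := by
      rw [ae_iff]
      simp only [not_not]
      exact hbad.measure_zero _
    filter_upwards [M.ae_deriv hy, hDn, e0, e1, hmono.ae_differentiableWithinAt_of_mem, hbad']
      with x h1 h2 h3 h4 h5 h6 hx
    have hx' : x ∈ Ioo (0:ℝ) 1 := ⟨lt_of_le_of_ne hx.1 (Ne.symm h3), lt_of_le_of_ne hx.2 h4⟩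
    have hFx := hp (x, y) ⟨hx, hy⟩
    have hd1 := ((h5 hx').differentiableAt (Ioo_mem_nhds hx'.1 hx'.2)).neg
    have hd2 : DifferentiableAt ℝ (fun t => fR φ t / fR φ (1/2)) x := by
      refine hd1.congr_of_eventuallyEq (Eventually.of_forall fun t => ?_)
      simp
    rcases (S.nonneg x hx).lt_or_eq with hpos | hzero
    · exact sec_pos_case S Sn hf hs hx' hFx (h1 hx') (fun n => h2 n hx') hd2.hasDerivAt hpos
    · have : ∃ x', x < x' ∧ x' ≤ 1 ∧ copFun2 d ψ φ (x', y) = 0 := by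
        by_contra hcon
        push Not at hcon
        exact h6 ⟨hzero.symm, hx', hcon⟩
      obtain ⟨x', ha, hb, hc⟩ := this
      exact sec_zero_case S Sn hf hs hx' hFx (h1 hx') (fun n => h2 n hx') ha hb hc

lemma unif_small {X : Type*} [PseudoMetricSpace X] {s : Set X} (hs : IsCompact s) {L : ℝ}
    (hL : 0 ≤ L) (g : ℕ → X → ℝ)
    (hlip : ∀ n, ∀ p ∈ s, ∀ q ∈ s, |g n p - g n q| ≤ L * dist p q)
    (hp : ∀ p ∈ s, Tendsto (fun n => g n p) atTop (𝓝 0)) {ε : ℝ} (hε : 0 < ε) :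
    ∀ᶠ n in atTop, ∀ p ∈ s, |g n p| < ε := by
  have hη : 0 < ε / (2 * (L + 1)) := by positivity
  obtain ⟨t, hts, htf, hcov⟩ := hs.finite_cover_balls hη
  have h1 : ∀ᶠ n in atTop, ∀ q ∈ t, |g n q| < ε / 2 := by
    rw [htf.eventually_all]
    intro q hq
    have := (hp q (hts hq)).abs
    rw [abs_zero] at this
    exact this.eventually_lt_const (by positivity)
  filter_upwards [h1] with n hn p hps
  obtain ⟨q, hq, hpq⟩ := mem_iUnion₂.1 (hcov hps)
  have h2 := hlip n p hps q (hts hq)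
  have h3 := hn q hq
  have h4 : dist p q < ε / (2 * (L + 1)) := hpq
  have h5 : L * dist p q ≤ ε / 2 := by
    calc L * dist p q ≤ (L + 1) * (ε / (2 * (L + 1))) := by
          apply mul_le_mul (by linarith) h4.le dist_nonneg (by linarith)
      _ = ε / 2 := by field_simp
  have h6 := abs_sub_abs_le_abs_sub (g n p) (g n q)
  linarith

lemma unitCube_eq (m : ℕ) : unitCube m = Icc (fun _ => (0:ℝ)) (fun _ => 1) := by
  ext t
  simp only [unitCube, mem_setOf_eq, mem_Icc, Pi.le_def]
  exact ⟨fun h => ⟨fun i => (h i).1, fun i => (h i).2⟩, fun h i => ⟨h.1 i, h.2 i⟩⟩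

lemma isCompact_cube (m : ℕ) : IsCompact (unitCube m) := by
  rw [unitCube_eq]; exact isCompact_Icc

lemma meas_cube (m : ℕ) : MeasurableSet (unitCube m) := by
  rw [unitCube_eq]; exact measurableSet_Icc

lemma vol_cube (m : ℕ) : volume (unitCube m) = 1 := by
  rw [unitCube_eq, Real.volume_Icc_pi]; simp

lemma sum_le_dist {m : ℕ} (y z : Fin m → ℝ) : ∑ j, |y j - z j| ≤ m * dist y z := by
  have : ∑ j, |y j - z j| ≤ ∑ _j : Fin m, dist y z :=
    Finset.sum_le_sum fun j _ => by rw [← Real.dist_eq]; exact dist_le_pi_dist y z j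
  simpa using this

/-- L1 distance of the kernels at a box -/
noncomputable def del {m : ℕ} (K K' : Kernel ℝ (Fin m → ℝ)) (y : Fin m → ℝ) : ℝ :=
  ∫ x in Icc (0:ℝ) 1, |(K x).real (lowerBox y) - (K' x).real (lowerBox y)|

lemma abs_kdiff {m : ℕ} {K K' : Kernel ℝ (Fin m → ℝ)} (hK : IsMarkovKernel K)
    (hK' : IsMarkovKernel K') (x : ℝ) (E : Set (Fin m → ℝ)) :
    |(K x).real E - (K' x).real E| ≤ 1 := by
  have h1 : (K x).real E ≤ 1 := measureReal_le_one
  have h2 : (K' x).real E ≤ 1 := measureReal_le_one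
  have h3 : 0 ≤ (K x).real E := measureReal_nonneg
  have h4 : 0 ≤ (K' x).real E := measureReal_nonneg
  rw [abs_le]; constructor <;> linarith

lemma kdiff_int {m : ℕ} {K K' : Kernel ℝ (Fin m → ℝ)} (hK : IsMarkovKernel K)
    (hK' : IsMarkovKernel K') {E E' : Set (Fin m → ℝ)} (hE : MeasurableSet E)
    (hE' : MeasurableSet E') (ν : Measure ℝ)
    [IsFiniteMeasure ν] : Integrable (fun x => |(K x).real E - (K' x).real E'|) ν :=
  ((CopM.kernel_int hK hE ν).sub (CopM.kernel_int hK' hE' ν)).abs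

lemma del_nonneg {m : ℕ} (K K' : Kernel ℝ (Fin m → ℝ)) (y : Fin m → ℝ) : 0 ≤ del K K' y :=
  integral_nonneg fun _ => abs_nonneg _

lemma del_le_one {m : ℕ} {K K' : Kernel ℝ (Fin m → ℝ)} (hK : IsMarkovKernel K)
    (hK' : IsMarkovKernel K') (y : Fin m → ℝ) : del K K' y ≤ 1 := by
  have h : del K K' y ≤ ∫ x in Icc (0:ℝ) 1, (1:ℝ) :=
    integral_mono (kdiff_int hK hK' (measurableSet_lowerBox y) (measurableSet_lowerBox y) _)
      (integrable_const _) fun x => abs_kdiff hK hK' x _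
  simpa using h

section
variable {m : ℕ} {μ μ' : Measure (ℝ × (Fin m → ℝ))} {C C' : ℝ × (Fin m → ℝ) → ℝ}
    {K K' : Kernel ℝ (Fin m → ℝ)}

lemma cop_le_del (M : CopM μ C K) (M' : CopM μ' C' K') {a : ℝ} (ha : a ∈ Icc (0:ℝ) 1)
    {y : Fin m → ℝ} (hy : y ∈ unitCube m) : |C (a, y) - C' (a, y)| ≤ del K K' y := by
  rw [M.C_eq ha hy, M'.C_eq ha hy, ← integral_sub (CopM.kernel_int M.mark (measurableSet_lowerBox y) _)
    (CopM.kernel_int M'.mark (measurableSet_lowerBox y) _)]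
  refine (abs_integral_le_integral_abs).trans ?_
  refine setIntegral_mono_set (kdiff_int M.mark M'.mark (measurableSet_lowerBox y)
    (measurableSet_lowerBox y) _) (Eventually.of_forall fun _ => abs_nonneg _) ?_
  exact (Icc_subset_Icc_right ha.2).eventuallyLE

lemma cop_lip_y (M : CopM μ C K) {a : ℝ} (ha : a ∈ Icc (0:ℝ) 1)
    {y z : Fin m → ℝ} (hy : y ∈ unitCube m) (hz : z ∈ unitCube m) :
    |C (a, y) - C (a, z)| ≤ ∑ j, |y j - z j| := by
  refine le_trans ?_ (M.lip_y hy hz)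
  rw [M.C_eq ha hy, M.C_eq ha hz, ← integral_sub (CopM.kernel_int M.mark (measurableSet_lowerBox y) _)
    (CopM.kernel_int M.mark (measurableSet_lowerBox z) _)]
  refine (abs_integral_le_integral_abs).trans ?_
  refine setIntegral_mono_set (kdiff_int M.mark M.mark (measurableSet_lowerBox y)
    (measurableSet_lowerBox z) _) (Eventually.of_forall fun _ => abs_nonneg _) ?_
  exact (Icc_subset_Icc_right ha.2).eventuallyLE

lemma cop_lip (M : CopM μ C K) {p q : ℝ × (Fin m → ℝ)} (hp : p ∈ Icc (0:ℝ) 1 ×ˢ unitCube m)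
    (hq : q ∈ Icc (0:ℝ) 1 ×ˢ unitCube m) : |C p - C q| ≤ (m + 1) * dist p q := by
  obtain ⟨a, y⟩ := p
  obtain ⟨b, z⟩ := q
  have h1 := M.lip_a hp.2 hp.1 hq.1
  have h2 := cop_lip_y M hq.1 hp.2 hq.2
  have h3 := sum_le_dist y z
  simp only at h1 h2
  have h4 : |a - b| ≤ dist (a, y) (b, z) := by
    rw [← Real.dist_eq, Prod.dist_eq]; exact le_max_left _ _
  have h5 : dist y z ≤ dist (a, y) (b, z) := by
    rw [Prod.dist_eq]; exact le_max_right _ _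
  have h6 := abs_sub_le (C (a, y)) (C (b, y)) (C (b, z))
  have h7 : (m:ℝ) * dist y z ≤ m * dist (a, y) (b, z) := by gcongr
  linarith

lemma del_lip (M : CopM μ C K) (M' : CopM μ' C' K') {y z : Fin m → ℝ} (hy : y ∈ unitCube m)
    (hz : z ∈ unitCube m) : del K K' y - del K K' z ≤ 2 * ∑ j, |y j - z j| := by
  have h1 := M.lip_y hy hz
  have h2 := M'.lip_y hy hz
  have i1 := kdiff_int M.mark M'.mark (measurableSet_lowerBox y) (measurableSet_lowerBox y)
    (volume.restrict (Icc (0:ℝ) 1))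
  have i2 := kdiff_int M.mark M'.mark (measurableSet_lowerBox z) (measurableSet_lowerBox z)
    (volume.restrict (Icc (0:ℝ) 1))
  have i3 := kdiff_int M.mark M.mark (measurableSet_lowerBox y) (measurableSet_lowerBox z)
    (volume.restrict (Icc (0:ℝ) 1))
  have i4 := kdiff_int M'.mark M'.mark (measurableSet_lowerBox y) (measurableSet_lowerBox z)
    (volume.restrict (Icc (0:ℝ) 1))
  have h3 : del K K' y ≤ ∫ x in Icc (0:ℝ) 1, (|(K x).real (lowerBox z) - (K' x).real (lowerBox z)|
      + (|(K x).real (lowerBox y) - (K x).real (lowerBox z)|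
        + |(K' x).real (lowerBox y) - (K' x).real (lowerBox z)|)) := by
    refine integral_mono i1 (i2.add (i3.add i4)) fun x => ?_
    simp only
    generalize (K x).real (lowerBox z) = a
    generalize (K x).real (lowerBox y) = b
    generalize (K' x).real (lowerBox z) = c
    generalize (K' x).real (lowerBox y) = e
    rw [abs_le]
    constructor <;> linarith [neg_abs_le (a - c), neg_abs_le (b - a), neg_abs_le (e - c), le_abs_self (a - c), le_abs_self (b - a), le_abs_self (e - c)]
  have i5 : Integrable (fun x => |(K x).real (lowerBox y) - (K x).real (lowerBox z)|
        + |(K' x).real (lowerBox y) - (K' x).real (lowerBox z)|) (volume.restrict (Icc (0:ℝ) 1)) :=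
    i3.add i4
  rw [integral_add i2 i5, integral_add i3 i4] at h3
  unfold del at *
  linarith

lemma le_Dinf (hK : IsMarkovKernel K) (hK' : IsMarkovKernel K') {y : Fin m → ℝ}
    (hy : y ∈ unitCube m) : del K K' y ≤ Dinf K K' := by
  unfold Dinf
  have hb : BddAbove (range fun y => ⨆ (_ : y ∈ unitCube m),
      ∫ x in Icc (0:ℝ) 1, |(K x (lowerBox y)).toReal - (K' x (lowerBox y)).toReal|) := by
    refine ⟨1, ?_⟩
    rintro _ ⟨z, rfl⟩
    exact Real.iSup_le (fun _ => del_le_one hK hK' z) zero_le_one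
  refine le_ciSup_of_le hb y ?_
  rw [ciSup_pos hy]
  rfl

lemma Dinf_le {ε : ℝ} (hε : 0 ≤ ε) (h : ∀ y ∈ unitCube m, del K K' y ≤ ε) : Dinf K K' ≤ ε :=
  Real.iSup_le (fun y => Real.iSup_le (fun hy => h y hy) hε) hε

lemma Dinf_nonneg : 0 ≤ Dinf K K' :=
  Real.iSup_nonneg fun y => Real.iSup_nonneg fun _ => del_nonneg K K' y

lemma joint_meas (hK : IsMarkovKernel K) :
    Measurable fun p : ℝ × (Fin m → ℝ) => (K p.1).real (lowerBox p.2) := by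
  have hs : MeasurableSet {q : (ℝ × (Fin m → ℝ)) × (Fin m → ℝ) | ∀ i, q.2 i ≤ q.1.2 i} := by
    have : {q : (ℝ × (Fin m → ℝ)) × (Fin m → ℝ) | ∀ i, q.2 i ≤ q.1.2 i} =
      ⋂ i, {q | q.2 i ≤ q.1.2 i} := by ext; simp
    rw [this]
    exact MeasurableSet.iInter fun i => measurableSet_le (by fun_prop) (by fun_prop)
  have := Kernel.measurable_kernel_prodMk_left (κ := K.comap Prod.fst measurable_fst) hs
  exact this.ennreal_toReal

/-- the difference of kernels -/
noncomputable def kd (K K' : Kernel ℝ (Fin m → ℝ)) (p : ℝ × (Fin m → ℝ)) : ℝ :=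
  (K p.1).real (lowerBox p.2) - (K' p.1).real (lowerBox p.2)

/-- the uniform measure -/
noncomputable abbrev uni (m : ℕ) : Measure (ℝ × (Fin m → ℝ)) := volume.restrict ((Icc (0:ℝ) 1) ×ˢ unitCube m)

lemma uni_eq : uni m = (volume.restrict (Icc (0:ℝ) 1)).prod (volume.restrict (unitCube m)) := by
  rw [Measure.prod_restrict]; rfl

lemma prob_cube : IsProbabilityMeasure (volume.restrict (unitCube m)) :=
  ⟨by rw [Measure.restrict_apply_univ, vol_cube]⟩

lemma prob_Icc : IsProbabilityMeasure (volume.restrict (Icc (0:ℝ) 1)) :=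
  ⟨by rw [Measure.restrict_apply_univ]; simp⟩

lemma prob_uni : IsProbabilityMeasure (uni m) := by
  have := prob_Icc
  have := prob_cube (m := m)
  rw [uni_eq]; infer_instance

lemma kd_meas (hK : IsMarkovKernel K) (hK' : IsMarkovKernel K') : Measurable (kd K K') :=
  (joint_meas hK).sub (joint_meas hK')

lemma kd_int (hK : IsMarkovKernel K) (hK' : IsMarkovKernel K') : Integrable (kd K K') (uni m) := by
  have := prob_uni (m := m)
  exact Integrable.of_bound (kd_meas hK hK').aestronglyMeasurable 1
    (Eventually.of_forall fun p => abs_kdiff hK hK' _ _)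

lemma kd_sq_int (hK : IsMarkovKernel K) (hK' : IsMarkovKernel K') :
    Integrable (fun p => kd K K' p ^ 2) (uni m) := by
  have := prob_uni (m := m)
  refine Integrable.of_bound ((kd_meas hK hK').pow_const 2).aestronglyMeasurable 1
    (Eventually.of_forall fun p => ?_)
  have := abs_kdiff hK hK' p.1 (lowerBox p.2)
  rw [Real.norm_eq_abs, abs_pow]
  exact pow_le_one₀ (abs_nonneg _) this

lemma D1_eq_abs : D1 K K' = ∫ p, |kd K K' p| ∂(uni m) := rfl

lemma D2_eq : D2sq K K' = ∫ p, kd K K' p ^ 2 ∂(uni m) := rfl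

lemma D1_eq (hK : IsMarkovKernel K) (hK' : IsMarkovKernel K') :
    D1 K K' = ∫ y in unitCube m, del K K' y := by
  have hi := (kd_int hK hK').abs
  rw [D1_eq_abs]
  rw [uni_eq] at hi ⊢
  rw [integral_prod_symm _ hi]
  rfl

lemma del_int (hK : IsMarkovKernel K) (hK' : IsMarkovKernel K') :
    Integrable (fun y => del K K' y) (volume.restrict (unitCube m)) := by
  have hi := (kd_int hK hK').abs
  rw [uni_eq] at hi
  exact hi.integral_prod_right

lemma D1_nonneg : 0 ≤ D1 K K' := integral_nonneg fun _ => abs_nonneg _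

lemma D1_le_Dinf (hK : IsMarkovKernel K) (hK' : IsMarkovKernel K') : D1 K K' ≤ Dinf K K' := by
  have := prob_cube (m := m)
  rw [D1_eq hK hK']
  have h : ∫ y in unitCube m, del K K' y ≤ ∫ y in unitCube m, Dinf K K' :=
    setIntegral_mono_on (del_int hK hK') (integrable_const _) (meas_cube m)
      fun y hy => le_Dinf hK hK' hy
  simpa [vol_cube, Measure.real] using h

lemma D2_le_D1 (hK : IsMarkovKernel K) (hK' : IsMarkovKernel K') : D2sq K K' ≤ D1 K K' := by
  rw [D2_eq, D1_eq_abs]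
  refine integral_mono (kd_sq_int hK hK') (kd_int hK hK').abs fun p => ?_
  have := abs_kdiff hK hK' p.1 (lowerBox p.2)
  change |kd K K' p| ≤ 1 at this
  simp only
  rw [← sq_abs]
  nlinarith [abs_nonneg (kd K K' p)]

lemma D1_le_sqrt (hK : IsMarkovKernel K) (hK' : IsMarkovKernel K') :
    D1 K K' ≤ Real.sqrt (D2sq K K') := by
  have := prob_uni (m := m)
  apply Real.le_sqrt_of_sq_le
  set D := D1 K K' with hD
  have h : 0 ≤ ∫ p, (|kd K K' p| - D) ^ 2 ∂(uni m) := integral_nonneg fun _ => sq_nonneg _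
  have e : ∀ p, (|kd K K' p| - D) ^ 2 = kd K K' p ^ 2 - 2 * D * |kd K K' p| + D ^ 2 := by
    intro p; rw [← sq_abs (kd K K' p)]; ring
  simp_rw [e] at h
  have i5 : Integrable (fun p => kd K K' p ^ 2 - 2 * D * |kd K K' p|) (uni m) :=
    (kd_sq_int hK hK').sub ((kd_int hK hK').abs.const_mul _)
  rw [integral_add i5 (integrable_const _),
    integral_sub (kd_sq_int hK hK') ((kd_int hK hK').abs.const_mul _), integral_const_mul,
    ← D2_eq, ← D1_eq_abs, ← hD] at h
  simp only [integral_const, probReal_univ, one_smul] at h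
  nlinarith

/-- localisation -/
lemma del_le_D1 {y0 : Fin m → ℝ} (hy0 : y0 ∈ unitCube m) {η : ℝ} (hη : 0 < η) :
    ∃ v : ℝ, 0 < v ∧ ∀ {μ μ' : Measure (ℝ × (Fin m → ℝ))} {C C' : ℝ × (Fin m → ℝ) → ℝ}
    {K K' : Kernel ℝ (Fin m → ℝ)}, CopM μ C K → CopM μ' C' K' →
      v * del K K' y0 ≤ D1 K K' + v * (2 * (m * η)) := by
  set B : Set (Fin m → ℝ) := Icc (fun j => max 0 (y0 j - η)) (fun j => min 1 (y0 j + η)) with hB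
  have hBc : B ⊆ unitCube m := by
    rw [unitCube_eq]
    exact Icc_subset_Icc (fun j => le_max_left _ _) (fun j => min_le_left _ _)
  have hBm : MeasurableSet B := measurableSet_Icc
  have hBfin : volume B ≠ ∞ := ((measure_mono hBc).trans_lt (by rw [vol_cube]; simp)).ne
  have hBpos : 0 < volume B := by
    rw [hB, Real.volume_Icc_pi]
    refine pos_iff_ne_zero.2 (Finset.prod_ne_zero_iff.2 fun j _ => ?_)
    rw [← pos_iff_ne_zero, ENNReal.ofReal_pos, sub_pos]
    have := hy0 j
    exact max_lt (lt_min zero_lt_one (by linarith [this.1]))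
      (lt_min (by linarith [this.2]) (by linarith))
  refine ⟨volume.real B, ENNReal.toReal_pos hBpos.ne' hBfin, ?_⟩
  intro μ μ' C C' K K' M M'
  have hdelint := del_int M.mark M'.mark
  have h1 : ∫ y in B, del K K' y ≤ D1 K K' := by
    rw [D1_eq M.mark M'.mark]
    exact setIntegral_mono_set hdelint (Eventually.of_forall fun y => del_nonneg K K' y)
      hBc.eventuallyLE
  have : IsFiniteMeasure (volume.restrict B) := ⟨by rw [Measure.restrict_apply_univ]; exact hBfin.lt_top⟩
  have hdelintB : Integrable (fun y => del K K' y) (volume.restrict B) := hdelint.mono_measure (Measure.restrict_mono hBc le_rfl)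
  have h2 : ∫ y in B, (del K K' y0 - 2 * (m * η)) ≤ ∫ y in B, del K K' y := by
    refine setIntegral_mono_on (integrable_const _) hdelintB hBm fun y hy => ?_
    have h3 := del_lip M M' hy0 (hBc hy)
    have h4 : ∑ j, |y0 j - y j| ≤ m * η := by
      have : ∑ j, |y0 j - y j| ≤ ∑ _j : Fin m, η := by
        refine Finset.sum_le_sum fun j _ => ?_
        have a1 := (le_max_right _ _).trans (hy.1 j)
        have a2 := (hy.2 j).trans (min_le_right _ _)
        rw [abs_le]; constructor <;> linarith
      simpa using this
    linarith
  rw [setIntegral_const, smul_eq_mul, mul_sub] at h2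
  linarith

end

/-- partially half-open rational boxes -/
def hbx {m : ℕ} (I : Finset (Fin m)) (l u : Fin m → ℚ) : Set (Fin m → ℝ) :=
  {t | ∀ i, t i ≤ u i ∧ (i ∈ I → (l i : ℝ) < t i)}

lemma hbx_meas {m : ℕ} (I : Finset (Fin m)) (l u : Fin m → ℚ) : MeasurableSet (hbx I l u) := by
  have : hbx I l u = ⋂ i, ({t : Fin m → ℝ | t i ≤ (u i : ℝ)} ∩ {t : Fin m → ℝ | i ∈ I → (l i : ℝ) < t i}) := by
    ext t; simp [hbx]
  rw [this]
  refine MeasurableSet.iInter fun i => (measurableSet_le (by fun_prop) (by fun_prop)).inter ?_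
  by_cases hi : i ∈ I
  · simp only [hi, true_imp_iff]
    exact measurableSet_lt (by fun_prop) (by fun_prop)
  · simp [hi]

lemma hbx_tendsto {m : ℕ} {νn : ℕ → Measure (Fin m → ℝ)} {ν : Measure (Fin m → ℝ)}
    (hn : ∀ n, IsProbabilityMeasure (νn n)) (hν : IsProbabilityMeasure ν)
    (h : ∀ u : Fin m → ℚ, Tendsto (fun n => (νn n).real (lowerBox fun i => (u i : ℝ))) atTop
      (𝓝 (ν.real (lowerBox fun i => (u i : ℝ))))) (l : Fin m → ℚ) (I : Finset (Fin m)) :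
    ∀ u : Fin m → ℚ, Tendsto (fun n => (νn n).real (hbx I l u)) atTop (𝓝 (ν.real (hbx I l u))) := by
  classical
  induction I using Finset.induction_on with
  | empty =>
    intro u
    have : hbx ∅ l u = lowerBox fun i => (u i : ℝ) := by ext t; simp [hbx, lowerBox]
    rw [this]; exact h u
  | insert j I hj ih =>
    intro u
    have hsub : hbx I l (Function.update u j (min (l j) (u j))) ⊆ hbx I l u := by
      intro t ht i
      refine ⟨(ht i).1.trans ?_, (ht i).2⟩
      by_cases hij : i = j
      · subst hij; simp
      · simp [Function.update_of_ne hij]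
    have e : hbx (insert j I) l u = hbx I l u \ hbx I l (Function.update u j (min (l j) (u j))) := by
      ext t
      constructor
      · intro ht
        refine ⟨fun i => ⟨(ht i).1, fun hi => (ht i).2 (Finset.mem_insert_of_mem hi)⟩, fun hc => ?_⟩
        have h1 := (hc j).1
        have h2 := (ht j).2 (Finset.mem_insert_self _ _)
        simp only [Function.update_self, Rat.cast_min, le_min_iff] at h1
        linarith [h1.1]
      · rintro ⟨h1, h2⟩ i
        refine ⟨(h1 i).1, fun hi => ?_⟩
        rcases Finset.mem_insert.1 hi with rfl | hi
        · by_contra hcon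
          refine h2 fun k => ⟨?_, (h1 k).2⟩
          by_cases hk : k = i
          · subst hk
            simp only [Function.update_self, Rat.cast_min, le_min_iff]
            exact ⟨not_lt.1 hcon, (h1 k).1⟩
          · simp only [Function.update_of_ne hk]
            exact (h1 k).1
        · exact (h1 i).2 hi
    rw [e]
    have ed : ∀ (ρ : Measure (Fin m → ℝ)) [IsProbabilityMeasure ρ], ρ.real (hbx I l u \ hbx I l (Function.update u j (min (l j) (u j)))) =
        ρ.real (hbx I l u) - ρ.real (hbx I l (Function.update u j (min (l j) (u j)))) :=
      fun ρ _ => measureReal_diff hsub (hbx_meas _ _ _)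
    simp only [ed]
    exact (ih _).sub (ih _)

lemma weak_of_boxes {m : ℕ} {νn : ℕ → Measure (Fin m → ℝ)} {ν : Measure (Fin m → ℝ)}
    (hn : ∀ n, IsProbabilityMeasure (νn n)) (hν : IsProbabilityMeasure ν)
    (h : ∀ u : Fin m → ℚ, Tendsto (fun n => (νn n).real (lowerBox fun i => (u i : ℝ))) atTop
      (𝓝 (ν.real (lowerBox fun i => (u i : ℝ))))) : WeakConv νn ν := by
  have key : Tendsto (β := ProbabilityMeasure (Fin m → ℝ)) (fun n => ⟨νn n, hn n⟩) atTop
      (@nhds (ProbabilityMeasure (Fin m → ℝ)) _ ⟨ν, hν⟩) := by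
    let S : Set (Set (Fin m → ℝ)) := {s | ∃ l u : Fin m → ℚ, s = hbx Finset.univ l u}
    have hS : IsPiSystem S := by
      rintro _ ⟨l, u, rfl⟩ _ ⟨l', u', rfl⟩ _
      refine ⟨fun i => max (l i) (l' i), fun i => min (u i) (u' i), ?_⟩
      ext t
      simp only [hbx, mem_inter_iff, mem_setOf_eq, Finset.mem_univ, true_imp_iff, Rat.cast_max,
        Rat.cast_min, le_min_iff, max_lt_iff]
      constructor
      · rintro ⟨a, b⟩ i; exact ⟨⟨(a i).1, (b i).1⟩, (a i).2, (b i).2⟩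
      · intro a; exact ⟨fun i => ⟨(a i).1.1, (a i).2.1⟩, fun i => ⟨(a i).1.2, (a i).2.2⟩⟩
    refine hS.tendsto_probabilityMeasure_of_tendsto_of_mem ?_ ?_ ?_
    · rintro _ ⟨l, u, rfl⟩; exact hbx_meas _ _ _
    · intro U hU x hx
      obtain ⟨ε, hε, hb⟩ := Metric.isOpen_iff.1 hU x hx
      have h1 : ∀ i, ∃ q : ℚ, x i - ε < q ∧ (q:ℝ) < x i := fun i => exists_rat_btwn (by linarith)
      have h2 : ∀ i, ∃ q : ℚ, x i < q ∧ (q:ℝ) < x i + ε := fun i => exists_rat_btwn (by linarith)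
      choose l hl using h1
      choose u hu using h2
      refine ⟨_, ⟨l, u, rfl⟩, ?_, ?_⟩
      · have e : hbx Finset.univ l u = Set.pi univ fun i => Ioc (l i : ℝ) (u i) := by
          ext t; simp only [hbx, mem_setOf_eq, Finset.mem_univ, true_imp_iff, Set.mem_pi, mem_univ, mem_Ioc]
          exact forall_congr' fun i => and_comm
        rw [e]
        exact set_pi_mem_nhds finite_univ fun i _ => Ioc_mem_nhds (hl i).2 (hu i).1
      · intro t ht
        apply hb
        rw [Metric.mem_ball, dist_pi_lt_iff hε]
        intro i
        have := ht i
        rw [Real.dist_eq, abs_lt]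
        have h3 := this.2 (Finset.mem_univ i)
        constructor <;> linarith [(hl i).1, (hu i).2, this.1]
    · rintro _ ⟨l, u, rfl⟩
      have := hbx_tendsto hn hν h l Finset.univ u
      rw [← NNReal.tendsto_coe]
      exact this
  exact ProbabilityMeasure.tendsto_iff_forall_integral_tendsto.1 key

lemma weak_box {m : ℕ} {νn : ℕ → Measure (Fin m → ℝ)} {ν : Measure (Fin m → ℝ)}
    (hn : ∀ n, IsProbabilityMeasure (νn n)) (hν : IsProbabilityMeasure ν)
    (h : WeakConv νn ν) {y : Fin m → ℝ} (hy : ν (frontier (lowerBox y)) = 0) :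
    Tendsto (fun n => (νn n).real (lowerBox y)) atTop (𝓝 (ν.real (lowerBox y))) := by
  have key : Tendsto (β := ProbabilityMeasure (Fin m → ℝ)) (fun n => ⟨νn n, hn n⟩) atTop
      (@nhds (ProbabilityMeasure (Fin m → ℝ)) _ ⟨ν, hν⟩) :=
    ProbabilityMeasure.tendsto_iff_forall_integral_tendsto.2 h
  have := ProbabilityMeasure.tendsto_measure_of_null_frontier_of_tendsto' key hy
  exact (ENNReal.tendsto_toReal (measure_ne_top ν _)).comp this

lemma del_tendsto {m : ℕ} {K : Kernel ℝ (Fin m → ℝ)} {Kn : ℕ → Kernel ℝ (Fin m → ℝ)}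
    (hK : IsMarkovKernel K) (hKn : ∀ n, IsMarkovKernel (Kn n)) {y : Fin m → ℝ}
    (h : ∀ᵐ x ∂(volume.restrict (Icc (0:ℝ) 1)),
      Tendsto (fun n => (Kn n x).real (lowerBox y)) atTop (𝓝 ((K x).real (lowerBox y)))) :
    Tendsto (fun n => del (Kn n) K y) atTop (𝓝 0) := by
  have := tendsto_integral_of_dominated_convergence (μ := volume.restrict (Icc (0:ℝ) 1))
    (F := fun n x => |(Kn n x).real (lowerBox y) - (K x).real (lowerBox y)|)
    (f := fun _ => 0) (fun _ => 1)
    (fun n => (kdiff_int (hKn n) hK (measurableSet_lowerBox y) (measurableSet_lowerBox y) _).aestronglyMeasurable)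
    (integrable_const _)
    (fun n => Eventually.of_forall fun x => by
      rw [Real.norm_eq_abs, abs_abs]; exact abs_kdiff (hKn n) hK x _)
    (by
      filter_upwards [h] with x hx
      have := (hx.sub_const ((K x).real (lowerBox y))).abs
      simpa using this)
  simpa [del] using this

theorem arch_convergence_characterization
    (d : ℕ) (hd : 2 ≤ d)
    (ψ : ℝ → ℝ) (φ : ℝ → ℝ≥0∞) (hgen : IsGenerator d ψ φ)
    (ψn : ℕ → ℝ → ℝ) (φn : ℕ → ℝ → ℝ≥0∞) (hgenn : ∀ n, IsGenerator d (ψn n) (φn n))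
    (μ : Measure (ℝ × (Fin (d - 1) → ℝ))) (hμp : IsProbabilityMeasure μ)
    (hμ : ∀ a ∈ Icc (0:ℝ) 1, ∀ y ∈ unitCube (d - 1),
      μ (Iic a ×ˢ lowerBox y) = ENNReal.ofReal (copFun2 d ψ φ (a, y)))
    (μn : ℕ → Measure (ℝ × (Fin (d - 1) → ℝ))) (hμnp : ∀ n, IsProbabilityMeasure (μn n))
    (hμn : ∀ n, ∀ a ∈ Icc (0:ℝ) 1, ∀ y ∈ unitCube (d - 1),
      μn n (Iic a ×ˢ lowerBox y) = ENNReal.ofReal (copFun2 d (ψn n) (φn n) (a, y)))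
    (K : Kernel ℝ (Fin (d - 1) → ℝ)) (hK : IsMarkovKernel K) (hdis : IsDisintegration μ K)
    (Kn : ℕ → Kernel ℝ (Fin (d - 1) → ℝ)) (hKn : ∀ n, IsMarkovKernel (Kn n))
    (hdisn : ∀ n, IsDisintegration (μn n) (Kn n)) :
    (TendstoUniformlyOn (fun n => copFun2 d (ψn n) (φn n)) (copFun2 d ψ φ) atTop
        ((Icc (0:ℝ) 1) ×ˢ unitCube (d - 1)) ↔
      ∀ p ∈ (Icc (0:ℝ) 1) ×ˢ unitCube (d - 1),
        Tendsto (fun n => copFun2 d (ψn n) (φn n) p) atTop (nhds (copFun2 d ψ φ p))) ∧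
    (TendstoUniformlyOn (fun n => copFun2 d (ψn n) (φn n)) (copFun2 d ψ φ) atTop
        ((Icc (0:ℝ) 1) ×ˢ unitCube (d - 1)) ↔
      Tendsto (fun n => D1 (Kn n) K) atTop (nhds 0)) ∧
    (TendstoUniformlyOn (fun n => copFun2 d (ψn n) (φn n)) (copFun2 d ψ φ) atTop
        ((Icc (0:ℝ) 1) ×ˢ unitCube (d - 1)) ↔
      Tendsto (fun n => Real.sqrt (D2sq (Kn n) K)) atTop (nhds 0)) ∧
    (TendstoUniformlyOn (fun n => copFun2 d (ψn n) (φn n)) (copFun2 d ψ φ) atTop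
        ((Icc (0:ℝ) 1) ×ˢ unitCube (d - 1)) ↔
      Tendsto (fun n => Dinf (Kn n) K) atTop (nhds 0)) ∧
    (TendstoUniformlyOn (fun n => copFun2 d (ψn n) (φn n)) (copFun2 d ψ φ) atTop
        ((Icc (0:ℝ) 1) ×ˢ unitCube (d - 1)) ↔
      ∃ Λ : Set ℝ, MeasurableSet Λ ∧ Λ ⊆ Icc (0:ℝ) 1 ∧ volume Λ = 1 ∧
        ∀ a ∈ Λ, WeakConv (fun n => Kn n a) (K a)) := by
  have M := copM_of_gen hgen hμp hμ hK hdis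
  have Mn := fun n => copM_of_gen (hgenn n) (hμnp n) (hμn n) (hKn n) (hdisn n)
  -- uniform iff pointwise
  have hUP : TendstoUniformlyOn (fun n => copFun2 d (ψn n) (φn n)) (copFun2 d ψ φ) atTop
        ((Icc (0:ℝ) 1) ×ˢ unitCube (d - 1)) ↔
      ∀ p ∈ (Icc (0:ℝ) 1) ×ˢ unitCube (d - 1),
        Tendsto (fun n => copFun2 d (ψn n) (φn n) p) atTop (nhds (copFun2 d ψ φ p)) := by
    refine ⟨fun h p hp => h.tendsto_at hp, fun h => ?_⟩
    rw [Metric.tendstoUniformlyOn_iff]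
    intro ε hε
    have := unif_small (isCompact_Icc.prod (isCompact_cube (d - 1)))
      (L := 2 * (((d - 1 : ℕ) : ℝ) + 1)) (by positivity)
      (fun n p => copFun2 d (ψn n) (φn n) p - copFun2 d ψ φ p)
      (fun n p hp q hq => by
        have h1 := cop_lip (Mn n) hp hq
        have h2 := cop_lip M hp hq
        rw [abs_le] at *
        constructor <;> linarith [h1.1, h1.2, h2.1, h2.2])
      (fun p hp => by simpa using (h p hp).sub_const (copFun2 d ψ φ p)) hε
    filter_upwards [this] with n hn p hp
    rw [dist_comm, Real.dist_eq]
    exact hn p hp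
  -- pointwise from convergence of `del`
  have hdelP : (∀ y ∈ unitCube (d - 1), Tendsto (fun n => del (Kn n) K y) atTop (𝓝 0)) →
      ∀ p ∈ (Icc (0:ℝ) 1) ×ˢ unitCube (d - 1),
        Tendsto (fun n => copFun2 d (ψn n) (φn n) p) atTop (nhds (copFun2 d ψ φ p)) := by
    rintro h ⟨a, y⟩ ⟨ha, hy⟩
    rw [tendsto_iff_dist_tendsto_zero]
    refine squeeze_zero (fun _ => dist_nonneg) (fun n => ?_) (h y hy)
    rw [Real.dist_eq]
    exact cop_le_del (Mn n) M ha hy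
  have hPdinf : (∀ p ∈ (Icc (0:ℝ) 1) ×ˢ unitCube (d - 1),
        Tendsto (fun n => copFun2 d (ψn n) (φn n) p) atTop (nhds (copFun2 d ψ φ p))) →
      Tendsto (fun n => Dinf (Kn n) K) atTop (nhds 0) := by
    intro h
    have h1 : ∀ y ∈ unitCube (d - 1), Tendsto (fun n => del (Kn n) K y) atTop (𝓝 0) :=
      fun y hy => del_tendsto hK hKn (main_ae hd hgen hgenn M Mn h hy)
    rw [Metric.tendsto_nhds]
    intro ε hε
    have := unif_small (isCompact_cube (d - 1))
      (L := 2 * ((d - 1 : ℕ) : ℝ)) (by positivity)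
      (fun n y => del (Kn n) K y)
      (fun n y hy z hz => by
        have h1 := del_lip (Mn n) M hy hz
        have h2 := del_lip (Mn n) M hz hy
        have h3 := sum_le_dist y z
        have h4 := sum_le_dist z y
        rw [dist_comm z y] at h4
        rw [abs_le]
        constructor <;> linarith) h1 (half_pos hε)
    filter_upwards [this] with n hn
    rw [Real.dist_eq, sub_zero, abs_of_nonneg Dinf_nonneg]
    have : Dinf (Kn n) K ≤ ε / 2 := Dinf_le (by positivity)
      fun y hy => (le_abs_self _).trans (hn y hy).le
    linarith
  have hD1P : Tendsto (fun n => D1 (Kn n) K) atTop (nhds 0) →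
      ∀ y ∈ unitCube (d - 1), Tendsto (fun n => del (Kn n) K y) atTop (𝓝 0) := by
    intro h y hy
    rw [Metric.tendsto_nhds]
    intro ε hε
    obtain ⟨v, hv, hvd⟩ := del_le_D1 hy (η := ε / (4 * (((d - 1 : ℕ) : ℝ) + 1))) (by positivity)
    have hev : ∀ᶠ n in atTop, D1 (Kn n) K < v * (ε / 2) := h.eventually_lt_const (by positivity)
    filter_upwards [hev] with n hn
    rw [Real.dist_eq, sub_zero, abs_of_nonneg (del_nonneg _ _ _)]
    have h1 := hvd (Mn n) M
    have h2 : 2 * (((d - 1 : ℕ) : ℝ) * (ε / (4 * (((d - 1 : ℕ) : ℝ) + 1)))) ≤ ε / 2 := by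
      have hD : (0:ℝ) ≤ ((d - 1 : ℕ) : ℝ) := Nat.cast_nonneg _
      generalize ((d - 1 : ℕ) : ℝ) = D at hD
      have e : 2 * (D * (ε / (4 * (D + 1)))) = (D / (D + 1)) * (ε / 2) := by
        field_simp; ring
      rw [e]
      have : D / (D + 1) ≤ 1 := (div_le_one (by linarith)).2 (by linarith)
      nlinarith
    have h3 : v * del (Kn n) K y < v * ε := by nlinarith
    exact lt_of_mul_lt_mul_left h3 hv.le
  have hInf1 : Tendsto (fun n => Dinf (Kn n) K) atTop (nhds 0) →
      Tendsto (fun n => D1 (Kn n) K) atTop (nhds 0) := fun h =>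
    squeeze_zero (fun _ => D1_nonneg) (fun n => D1_le_Dinf (hKn n) hK) h
  have h12 : Tendsto (fun n => D1 (Kn n) K) atTop (nhds 0) →
      Tendsto (fun n => Real.sqrt (D2sq (Kn n) K)) atTop (nhds 0) := fun h => by
    have h2 := (Real.continuous_sqrt.tendsto 0).comp h
    rw [Real.sqrt_zero] at h2
    exact squeeze_zero (fun _ => Real.sqrt_nonneg _)
      (fun n => Real.sqrt_le_sqrt (D2_le_D1 (hKn n) hK)) h2
  have h21 : Tendsto (fun n => Real.sqrt (D2sq (Kn n) K)) atTop (nhds 0) →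
      Tendsto (fun n => D1 (Kn n) K) atTop (nhds 0) := fun h =>
    squeeze_zero (fun _ => D1_nonneg) (fun n => D1_le_sqrt (hKn n) hK) h
  refine ⟨hUP, ?_, ?_, ?_, ?_⟩
  · exact ⟨fun h => hInf1 (hPdinf (hUP.1 h)), fun h => hUP.2 (hdelP (hD1P h))⟩
  · exact ⟨fun h => h12 (hInf1 (hPdinf (hUP.1 h))), fun h => hUP.2 (hdelP (hD1P (h21 h)))⟩
  · exact ⟨fun h => hPdinf (hUP.1 h), fun h => hUP.2 (hdelP (hD1P (hInf1 h)))⟩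
  · constructor
    · intro h
      have h0 := hUP.1 h
      have hall : ∀ᵐ x ∂(volume.restrict (Icc (0:ℝ) 1)), ∀ u : Fin (d - 1) → ℚ,
          Tendsto (fun n => (Kn n x).real (lowerBox fun i => (u i : ℝ))) atTop
            (𝓝 ((K x).real (lowerBox fun i => (u i : ℝ)))) := by
        rw [ae_all_iff]
        intro u
        have hc : (fun j => max 0 (min (u j : ℝ) 1)) ∈ unitCube (d - 1) := fun j =>
          ⟨le_max_left _ _, max_le zero_le_one (min_le_right _ _)⟩
        filter_upwards [main_ae hd hgen hgenn M Mn h0 hc, M.ae_clamp (fun i => (u i : ℝ)),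
          ae_all_iff.2 fun n => (Mn n).ae_clamp (fun i => (u i : ℝ))] with x h1 h2 h3
        rw [h2]
        simp only [h3]
        exact h1
      obtain ⟨s, hs, hsm, hs0⟩ := exists_measurable_superset_of_null (ae_iff.1 hall)
      refine ⟨Icc 0 1 \ s, measurableSet_Icc.diff hsm, diff_subset, ?_, ?_⟩
      · rw [Measure.restrict_apply hsm] at hs0
        rw [measure_sdiff_null' (by rwa [inter_comm] at hs0)]
        simp
      · intro a ha
        refine weak_of_boxes (fun n => inferInstance) inferInstance ?_
        by_contra hcon
        exact ha.2 (hs hcon)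
    · rintro ⟨Λ, hΛm, hΛs, hΛ1, hw⟩
      refine hUP.2 (hdelP fun y hy => del_tendsto hK hKn ?_)
      have hΛ : ∀ᵐ x ∂(volume.restrict (Icc (0:ℝ) 1)), x ∈ Λ := by
        rw [ae_restrict_iff' measurableSet_Icc, ae_iff]
        have := measure_diff hΛs hΛm.nullMeasurableSet (by rw [hΛ1]; simp) (μ := volume)
        rw [hΛ1, Real.volume_Icc] at this
        simp only [sub_zero, ENNReal.ofReal_one, tsub_self] at this
        refine measure_mono_null ?_ this
        intro x hx
        simp only [mem_setOf_eq, Classical.not_imp] at hx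
        exact hx
      filter_upwards [hΛ, M.ae_frontier y] with x h1 h2
      exact weak_box (fun n => inferInstance) inferInstance (hw x h1) h2
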